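/- There exist constants C > 0 and T0 ≥ 2 such that for all T ≥ T0, the number of tuples (x1, x2, x3, y1, y2, y3) counted by N(T) which in addition satisfy |y1*y2*y3| > T^(1/2) is at most C * T^(1/2) * (log T)^3. -/

import Mathlib

open Real

/-- The conditions defining the tuples counted by `N(T)`. -/
def StackyCounted (T : ℝ) (x1 x2 x3 y1 y2 y3 : ℤ) : Prop :=
  x1 ≠ 0 ∧ x2 ≠ 0 ∧ x3 ≠ 0 ∧ y1 ≠ 0 ∧ y2 ≠ 0 ∧ y3 ≠ 0 ∧
  Int.gcd x1 x2 = 1 ∧ Int.gcd x1 x3 = 1 ∧ Int.gcd x2 x3 = 1 ∧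
  Int.gcd y1 y2 = 1 ∧ Int.gcd y1 y3 = 1 ∧ Int.gcd y2 y3 = 1 ∧
  Squarefree x1 ∧ Squarefree x2 ∧ Squarefree x3 ∧
  x1 * y1 ^ 2 + x2 * y2 ^ 2 = x3 * y3 ^ 2 ∧
  0 < x1 ∧ |x2 * y2 ^ 2| ≤ x1 * y1 ^ 2 ∧
  ((|(x1 * y1) ^ 2 * x2 * x3| : ℤ) : ℝ) ≤ T

/-- The number of tuples counted by `N(T)` which moreover satisfy `|y1*y2*y3| > √T`. -/
noncomputable def stackyNlargeY (T : ℝ) : ℕ :=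
  Set.ncard {v : ℤ × ℤ × ℤ × ℤ × ℤ × ℤ |
    StackyCounted T v.1 v.2.1 v.2.2.1 v.2.2.2.1 v.2.2.2.2.1 v.2.2.2.2.2 ∧
    Real.sqrt T < ((|v.2.2.2.1 * v.2.2.2.2.1 * v.2.2.2.2.2| : ℤ) : ℝ)}

/-- A finite family of `δ`-separated reals in an interval of length `l` has at most `1 + l / δ`
members. -/
lemma card_le_of_separated {ι : Type*} (s : Finset ι) (f : ι → ℝ) {a l δ : ℝ} (hδ : 0 < δ)
    (hl : 0 ≤ l) (hf : ∀ x ∈ s, a ≤ f x ∧ f x ≤ a + l)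
    (hsep : ∀ x ∈ s, ∀ y ∈ s, x ≠ y → δ ≤ |f x - f y|) : (s.card : ℝ) ≤ 1 + l / δ := by
  have hcard : s.card ≤ (Finset.Icc (0 : ℤ) ⌊l / δ⌋).card := by
    apply Finset.card_le_card_of_injOn (fun x => ⌊(f x - a) / δ⌋)
    · intro x hx
      obtain ⟨h1, h2⟩ := hf x hx
      simp only [Finset.coe_Icc, Set.mem_Icc]
      refine ⟨Int.floor_nonneg.2 (div_nonneg (by linarith) hδ.le), Int.floor_le_floor ?_⟩
      gcongr
      linarith
    · intro x hx y hy hxy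
      by_contra hne
      have h := Int.abs_sub_lt_one_of_floor_eq_floor hxy
      rw [← sub_div, abs_div, abs_of_pos hδ, div_lt_one hδ] at h
      have := hsep x hx y hy hne
      rw [show f x - a - (f y - a) = f x - f y by ring] at h
      linarith
  have h0 : (0 : ℤ) ≤ ⌊l / δ⌋ := Int.floor_nonneg.2 (by positivity)
  rw [Int.card_Icc] at hcard
  have h1 : (s.card : ℤ) ≤ ⌊l / δ⌋ + 1 := by omega
  have h2 : (s.card : ℝ) ≤ ⌊l / δ⌋ + 1 := by exact_mod_cast h1
  linarith [Int.floor_le (l / δ)]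

/-- Positive, squarefree, pairwise coprime coefficients of a diagonal conic. -/
structure IsConicCoeff (A B C : ℤ) : Prop where
  posA : 0 < A
  posB : 0 < B
  posC : 0 < C
  copAB : IsCoprime A B
  copAC : IsCoprime A C
  copBC : IsCoprime B C
  sqA : Squarefree A
  sqB : Squarefree B
  sqC : Squarefree C

/-- Integral points with pairwise coprime coordinates on the conic `A u² + B v² = C w²`. -/
structure IsConicPoint (A B C u v w : ℤ) : Prop where
  eqn : A * u ^ 2 + B * v ^ 2 = C * w ^ 2
  copuv : IsCoprime u v
  copuw : IsCoprime u w
  copvw : IsCoprime v w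

lemma isCoprime_of_mul_sq_mem {x b c z k m : ℤ} (hbc : IsCoprime b c) (hxz : IsCoprime x z)
    (h : c * z ^ 2 = x * k + b * m) : IsCoprime x b := by
  obtain ⟨α, β, h1⟩ := (IsCoprime.pow_right hxz : IsCoprime x (z ^ 2))
  obtain ⟨γ, ε, h2⟩ := hbc
  exact ⟨α * (γ * b + ε * c) + β * ε * k, β * γ * z ^ 2 + β * ε * m, by
    linear_combination (γ * b + ε * c) * h1 + h2 - β * ε * h⟩

namespace IsConicPoint

variable {A B C u v w : ℤ}

lemma cop_u_B (h : IsConicPoint A B C u v w) (hc : IsConicCoeff A B C) : IsCoprime u B :=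
  isCoprime_of_mul_sq_mem (k := A * u) (m := v ^ 2) hc.copBC h.copuw
    (by linear_combination -h.eqn)

lemma cop_u_C (h : IsConicPoint A B C u v w) (hc : IsConicCoeff A B C) : IsCoprime u C :=
  isCoprime_of_mul_sq_mem (k := -A * u) (m := w ^ 2) hc.copBC.symm h.copuv
    (by linear_combination h.eqn)

lemma cop_v_A (h : IsConicPoint A B C u v w) (hc : IsConicCoeff A B C) : IsCoprime v A :=
  isCoprime_of_mul_sq_mem (k := B * v) (m := u ^ 2) hc.copAC h.copvw
    (by linear_combination -h.eqn)

lemma cop_v_C (h : IsConicPoint A B C u v w) (hc : IsConicCoeff A B C) : IsCoprime v C :=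
  isCoprime_of_mul_sq_mem (k := -B * v) (m := w ^ 2) hc.copAC.symm h.copuv.symm
    (by linear_combination h.eqn)

lemma cop_w_A (h : IsConicPoint A B C u v w) (hc : IsConicCoeff A B C) : IsCoprime w A :=
  isCoprime_of_mul_sq_mem (k := C * w) (m := -u ^ 2) hc.copAB h.copvw.symm
    (by linear_combination h.eqn)

lemma cop_w_B (h : IsConicPoint A B C u v w) (hc : IsConicCoeff A B C) : IsCoprime w B :=
  isCoprime_of_mul_sq_mem (k := C * w) (m := -v ^ 2) hc.copAB.symm h.copuw.symm
    (by linear_combination h.eqn)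

end IsConicPoint

/-- Thue's lemma with weights: the congruence `n ∣ α a + β b` has a non-trivial solution with
`A a² + B b² ≤ 2 n √(A B)`. -/
lemma exists_small_congruence_solution {A B n : ℤ} (hA : 0 < A) (hB : 0 < B) (hn : 0 < n)
    (α β : ℤ) : ∃ a b : ℤ, (a ≠ 0 ∨ b ≠ 0) ∧ n ∣ α * a + β * b ∧
      ((A * a ^ 2 + B * b ^ 2 : ℤ) : ℝ) ≤ 2 * n * √((A : ℝ) * B) := by
  have hA' : (0 : ℝ) < A := by exact_mod_cast hA
  have hB' : (0 : ℝ) < B := by exact_mod_cast hB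
  have hn' : (0 : ℝ) < n := by exact_mod_cast hn
  set s : ℝ := √((A : ℝ) * B) with hs
  have hs0 : 0 < s := Real.sqrt_pos.2 (by positivity)
  have hs2 : s ^ 2 = A * B := Real.sq_sqrt (by positivity)
  set σ : ℝ := √(n * s / A) with hσ
  set τ : ℝ := √(n * s / B) with hτ
  have hσ2 : σ ^ 2 = n * s / A := Real.sq_sqrt (by positivity)
  have hτ2 : τ ^ 2 = n * s / B := Real.sq_sqrt (by positivity)
  have hσ0 : 0 < σ := Real.sqrt_pos.2 (by positivity)
  have hτ0 : 0 < τ := Real.sqrt_pos.2 (by positivity)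
  have hστ : σ * τ = n := by
    have : (σ * τ) ^ 2 = (n : ℝ) ^ 2 := by
      rw [mul_pow, hσ2, hτ2]
      field_simp
      rw [hs2]
    exact (pow_left_inj₀ (by positivity) hn'.le two_ne_zero).1 this
  let D := Finset.Icc (0 : ℤ) ⌊σ⌋ ×ˢ Finset.Icc (0 : ℤ) ⌊τ⌋
  have hfσ : 0 ≤ ⌊σ⌋ := Int.floor_nonneg.2 hσ0.le
  have hfτ : 0 ≤ ⌊τ⌋ := Int.floor_nonneg.2 hτ0.le
  have hcard : (Finset.Ico (0 : ℤ) n).card < D.card := by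
    simp only [D, Finset.card_product, Int.card_Icc, Int.card_Ico]
    zify
    rw [Int.toNat_of_nonneg (by omega), Int.toNat_of_nonneg (by omega),
      Int.toNat_of_nonneg (by omega)]
    have h1 := Int.lt_floor_add_one σ
    have h2 := Int.lt_floor_add_one τ
    have : (n : ℝ) < (⌊σ⌋ + 1) * (⌊τ⌋ + 1) := by
      rw [← hστ]; gcongr
    have h3 : n < (⌊σ⌋ + 1) * (⌊τ⌋ + 1) := by exact_mod_cast this
    linarith
  obtain ⟨x, hx, y, hy, hxy, he⟩ := Finset.exists_ne_map_eq_of_card_lt_of_maps_to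
    (f := fun p : ℤ × ℤ => (α * p.1 + β * p.2) % n) hcard (by
      intro p _
      simp only [Finset.coe_Ico, Set.mem_Ico]
      exact ⟨Int.emod_nonneg _ hn.ne', Int.emod_lt_of_pos _ hn⟩)
  simp only [D, Finset.mem_product, Finset.mem_Icc] at hx hy
  refine ⟨x.1 - y.1, x.2 - y.2, ?_, ?_, ?_⟩
  · by_contra! h
    exact hxy (Prod.ext (by omega) (by omega))
  · have h := Int.ModEq.dvd (he : α * x.1 + β * x.2 ≡ α * y.1 + β * y.2 [ZMOD n]).symm
    exact (by convert h using 1; ring)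
  · have h1 : ((x.1 - y.1 : ℤ) : ℝ) ^ 2 ≤ σ ^ 2 := by
      have : |x.1 - y.1| ≤ ⌊σ⌋ := by rw [abs_le]; constructor <;> omega
      have h : |((x.1 - y.1 : ℤ) : ℝ)| ≤ σ := by
        have : ((|x.1 - y.1| : ℤ) : ℝ) ≤ ⌊σ⌋ := by exact_mod_cast this
        rw [Int.cast_abs] at this
        exact this.trans (Int.floor_le σ)
      exact sq_le_sq' (abs_le.1 h).1 (abs_le.1 h).2
    have h2 : ((x.2 - y.2 : ℤ) : ℝ) ^ 2 ≤ τ ^ 2 := by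
      have : |x.2 - y.2| ≤ ⌊τ⌋ := by rw [abs_le]; constructor <;> omega
      have h : |((x.2 - y.2 : ℤ) : ℝ)| ≤ τ := by
        have : ((|x.2 - y.2| : ℤ) : ℝ) ≤ ⌊τ⌋ := by exact_mod_cast this
        rw [Int.cast_abs] at this
        exact this.trans (Int.floor_le τ)
      exact sq_le_sq' (abs_le.1 h).1 (abs_le.1 h).2
    calc (((A * (x.1 - y.1) ^ 2 + B * (x.2 - y.2) ^ 2 : ℤ)) : ℝ)
        = A * ((x.1 - y.1 : ℤ) : ℝ) ^ 2 + B * ((x.2 - y.2 : ℤ) : ℝ) ^ 2 := by push_cast; ring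
      _ ≤ A * σ ^ 2 + B * τ ^ 2 := by gcongr
      _ = 2 * n * s := by rw [hσ2, hτ2]; field_simp; ring

/-- Every conic point `(u, v, w)` has a small integral point of the conic in its lattice. -/
lemma exists_small_lattice_point {A B C u v w : ℤ} (hc : IsConicCoeff A B C)
    (h : IsConicPoint A B C u v w) (hw : 0 < w) :
    ∃ u' v' w' : ℤ, 0 < w' ∧ A * u' ^ 2 + B * v' ^ 2 = C * w' ^ 2 ∧ w' ^ 2 ≤ 4 * (A * B) ∧
      A ∣ v * w' - w * v' ∧ B ∣ u * w' - w * u' ∧ C ∣ u * v' - v * u' := by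
  have hA := hc.posA
  have hB := hc.posB
  have hC := hc.posC
  have hn : 0 < C * w := mul_pos hC hw
  obtain ⟨a, b, hab, ⟨c, hL⟩, hN⟩ := exists_small_congruence_solution hA hB hn (A * u) (B * v)
  have heq := h.eqn
  have copA : IsCoprime (C * w ^ 2) (A * u) :=
    IsCoprime.mul_left (IsCoprime.mul_right hc.copAC.symm (h.cop_u_C hc).symm)
      (IsCoprime.pow_left (IsCoprime.mul_right (h.cop_w_A hc) h.copuw.symm))
  have copB : IsCoprime (C * w ^ 2) (B * v) :=
    IsCoprime.mul_left (IsCoprime.mul_right hc.copBC.symm (h.cop_v_C hc).symm)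
      (IsCoprime.pow_left (IsCoprime.mul_right (h.cop_w_B hc) h.copvw.symm))
  have copA' : IsCoprime (C * w) (A * u) :=
    copA.of_isCoprime_of_dvd_left ⟨w, by ring⟩
  obtain ⟨u', hu'⟩ : C * w ^ 2 ∣ 2 * a * (A * u * a + B * v * b) - u * (A * a ^ 2 + B * b ^ 2) := by
    apply copA.dvd_of_dvd_mul_left
    exact ⟨C * c ^ 2 - B * b ^ 2, by
      linear_combination (A * u * a + B * v * b + C * w * c) * hL - B * b ^ 2 * heq⟩
  obtain ⟨v', hv'⟩ : C * w ^ 2 ∣ 2 * b * (A * u * a + B * v * b) - v * (A * a ^ 2 + B * b ^ 2) := by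
    apply copB.dvd_of_dvd_mul_left
    exact ⟨C * c ^ 2 - A * a ^ 2, by
      linear_combination (A * u * a + B * v * b + C * w * c) * hL - A * a ^ 2 * heq⟩
  obtain ⟨g, hg⟩ : C * w ∣ u * b - v * a := by
    apply copA'.dvd_of_dvd_mul_left
    exact ⟨w * b - v * c, by linear_combination b * heq - v * hL⟩
  obtain ⟨w', hw'⟩ : C * w ∣ A * a ^ 2 + B * b ^ 2 := by
    apply copA'.dvd_of_dvd_mul_left
    exact ⟨a * A * c + A * B * b * g, by linear_combination a * A * hL + A * B * b * hg⟩
  have hCw2 : C * w ^ 2 ≠ 0 := by positivity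
  have hNpos : 0 < A * a ^ 2 + B * b ^ 2 := by
    rcases hab with h0 | h0 <;> positivity
  have hw'pos : 0 < w' := by
    rw [hw'] at hNpos
    exact (mul_pos_iff_of_pos_left hn).1 hNpos
  refine ⟨u', v', w', hw'pos, ?_, ?_, ?_, ?_, ?_⟩
  · apply mul_left_cancel₀ (pow_ne_zero 2 hCw2)
    have e1 : (C * w ^ 2) ^ 2 * (A * u' ^ 2 + B * v' ^ 2)
        = A * (C * w ^ 2 * u') ^ 2 + B * (C * w ^ 2 * v') ^ 2 := by ring
    have e2 : (C * w ^ 2) ^ 2 * (C * w' ^ 2) = C * w ^ 2 * (C * w * w') ^ 2 := by ring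
    rw [e1, e2, ← hu', ← hv', ← hw', ← heq]
    ring
  · have hn' : (0 : ℝ) < (C * w : ℤ) := by exact_mod_cast hn
    rw [hw', Int.cast_mul] at hN
    have h1 : (w' : ℝ) ≤ 2 * √((A : ℝ) * B) := by
      apply le_of_mul_le_mul_left _ hn'
      linarith
    have h0 : (0 : ℝ) ≤ w' := by exact_mod_cast hw'pos.le
    have h2 : (w' : ℝ) ^ 2 ≤ 4 * ((A : ℝ) * B) := by
      have hAB : (0 : ℝ) ≤ (A : ℝ) * B := by exact_mod_cast (mul_pos hA hB).le
      calc (w' : ℝ) ^ 2 ≤ (2 * √((A : ℝ) * B)) ^ 2 := by gcongr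
        _ = 4 * ((A : ℝ) * B) := by rw [mul_pow, Real.sq_sqrt hAB]; ring
    exact_mod_cast h2
  · refine ⟨-2 * a * g, mul_left_cancel₀ hCw2 ?_⟩
    linear_combination (-v * w) * hw' + w * hv' - 2 * w * A * a * hg
  · refine ⟨2 * b * g, mul_left_cancel₀ hCw2 ?_⟩
    linear_combination (-u * w) * hw' + w * hu' + 2 * w * B * b * hg
  · refine ⟨2 * c * g, mul_left_cancel₀ hCw2 ?_⟩
    linear_combination (-u) * hv' + v * hu' + 2 * (u * b - v * a) * hL + 2 * C * w * c * hg

/-- The two points with cross term `x = v w'`, `y = w v'` agree up to sign modulo `A`, the sign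
being `-` exactly on the divisor `d`. -/
def AgreeUpToSign (A d x y : ℤ) : Prop :=
  ∃ e, A = d * e ∧ e ∣ x - y ∧ d ∣ x + y

lemma exists_agreeUpToSign {A n x y : ℤ} (hA : 0 < A) (hsq : Squarefree A)
    (h2 : A ∣ (x - y) * (x + y)) (hn : A ∣ n * (x - y)) :
    ∃ d, 0 < d ∧ d ∣ A ∧ d ∣ n ∧ AgreeUpToSign A d x y := by
  obtain ⟨d, hd⟩ : (Int.gcd A (x - y) : ℤ) ∣ A := Int.gcd_dvd_left ..
  set e : ℤ := (Int.gcd A (x - y) : ℤ) with he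
  have he0 : 0 < e := by
    have : 0 ≤ e := by positivity
    rcases this.lt_or_eq with h | h
    · exact h
    · rw [← h] at hd; simp at hd; omega
  have hd0 : 0 < d := by
    rw [hd] at hA
    exact (mul_pos_iff_of_pos_left he0).1 hA
  have hcop : IsCoprime d (x - y) := by
    rw [Int.isCoprime_iff_gcd_eq_one]
    have hg1 : (Int.gcd d (x - y) : ℤ) ∣ d := Int.gcd_dvd_left ..
    have hg2 : (Int.gcd d (x - y) : ℤ) ∣ x - y := Int.gcd_dvd_right ..
    have hg3 : (Int.gcd d (x - y) : ℤ) ∣ e := Int.dvd_coe_gcd (hg1.trans ⟨e, by rw [hd]; ring⟩) hg2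
    have := hsq _ (by rw [hd]; exact mul_dvd_mul hg3 hg1)
    have := Int.isUnit_iff.1 this
    omega
  have hdA : d ∣ A := ⟨e, by rw [hd]; ring⟩
  refine ⟨d, hd0, hdA, ?_, e, by rw [hd]; ring, Int.gcd_dvd_right .., ?_⟩
  · exact hcop.dvd_of_dvd_mul_right (hdA.trans hn)
  · exact hcop.dvd_of_dvd_mul_left (hdA.trans h2)

/-- Two sign patterns relative to the same invertible reference agree. -/
lemma AgreeUpToSign.dvd_sub {A d v w v' w' s t : ℤ}
    (h : AgreeUpToSign A d (v * t) (w * s)) (h' : AgreeUpToSign A d (v' * t) (w' * s))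
    (hsq : Squarefree A) (hs : IsCoprime s A) (ht : IsCoprime t A) : A ∣ v * w' - w * v' := by
  obtain ⟨e, he, h1, h2⟩ := h
  obtain ⟨e', he', h1', h2'⟩ := h'
  have hd : d ≠ 0 := by
    rintro rfl
    rw [zero_mul] at he
    exact hsq.ne_zero he
  obtain rfl : e = e' := mul_left_cancel₀ hd (he.symm.trans he')
  have hde : IsCoprime d e := by
    rw [Int.isCoprime_iff_gcd_eq_one]
    have := hsq (Int.gcd d e : ℤ)
      (by rw [he]; exact mul_dvd_mul (Int.gcd_dvd_left ..) (Int.gcd_dvd_right ..))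
    have := Int.isUnit_iff.1 this
    omega
  have hst : IsCoprime A (s * t) := (IsCoprime.mul_left hs ht).symm
  apply hst.dvd_of_dvd_mul_left
  rw [he]
  apply hde.mul_dvd
  · have := _root_.dvd_sub (dvd_mul_of_dvd_right h2 (w' * s)) (dvd_mul_of_dvd_right h2' (w * s))
    convert this using 1; ring
  · have := _root_.dvd_sub (dvd_mul_of_dvd_right h1 (w' * s)) (dvd_mul_of_dvd_right h1' (w * s))
    convert this using 1; ring

lemma isCoprime_of_sq_dvd {x y z C : ℤ} (hC : Squarefree C)
    (hxyz : ∀ p : ℤ, Prime p → p ∣ x → p ∣ y → ¬ p ∣ z)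
    (h : ∀ p : ℤ, p ∣ x → p ∣ y → p ^ 2 ∣ C * z ^ 2) (h0 : ¬ (x = 0 ∧ y = 0)) :
    IsCoprime x y := by
  apply isCoprime_of_prime_dvd h0
  intro p hp hx hy
  have hz := hxyz p hp hx hy
  have h1 : IsCoprime (p ^ 2) (z ^ 2) := IsCoprime.pow ((hp.coprime_iff_not_dvd).2 hz)
  have h2 : p * p ∣ C := by
    rw [← sq]; exact h1.dvd_of_dvd_mul_right (h p hx hy)
  exact hp.not_isUnit (hC p h2)

/-- A non-zero integral point is a multiple of a point with pairwise coprime coordinates. -/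
lemma exists_primitive {A B C u v w : ℤ} (hc : IsConicCoeff A B C) (hw : 0 < w)
    (h : A * u ^ 2 + B * v ^ 2 = C * w ^ 2) :
    ∃ n u' v' w' : ℤ, 0 < n ∧ 0 < w' ∧ u = n * u' ∧ v = n * v' ∧ w = n * w' ∧
      IsConicPoint A B C u' v' w' := by
  set n : ℤ := gcd (gcd u v) w with hn
  have hnw : n ∣ w := gcd_dvd_right _ _
  have hnu : n ∣ u := (gcd_dvd_left _ _).trans (gcd_dvd_left _ _)
  have hnv : n ∣ v := (gcd_dvd_left _ _).trans (gcd_dvd_right _ _)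
  have hn0 : 0 < n := by
    have h1 : n ≠ 0 := by rintro h0; rw [h0, zero_dvd_iff] at hnw; omega
    have h2 : 0 ≤ n := by rw [hn, ← Int.coe_gcd]; positivity
    omega
  obtain ⟨u', hu⟩ := hnu
  obtain ⟨v', hv⟩ := hnv
  obtain ⟨w', hw'⟩ := hnw
  have hw0 : 0 < w' := by
    rw [hw'] at hw; exact (mul_pos_iff_of_pos_left hn0).1 hw
  have hp : ∀ p : ℤ, Prime p → p ∣ u' → p ∣ v' → ¬ p ∣ w' := by
    intro p hp h1 h2 h3
    have : n * p ∣ n := by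
      conv_rhs => rw [hn]
      refine dvd_gcd (dvd_gcd ?_ ?_) ?_
      · rw [hu]; exact mul_dvd_mul_left n h1
      · rw [hv]; exact mul_dvd_mul_left n h2
      · rw [hw']; exact mul_dvd_mul_left n h3
    have h4 : p ∣ 1 := by
      apply (mul_dvd_mul_iff_left hn0.ne').1
      rwa [mul_one]
    exact hp.not_isUnit (isUnit_of_dvd_one h4)
  have heq : A * u' ^ 2 + B * v' ^ 2 = C * w' ^ 2 := by
    apply mul_left_cancel₀ (pow_ne_zero 2 hn0.ne')
    rw [hu, hv, hw'] at h
    linear_combination h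
  refine ⟨n, u', v', w', hn0, hw0, hu, hv, hw', heq, ?_, ?_, ?_⟩
  · apply isCoprime_of_sq_dvd hc.sqC (z := w') hp
    · rintro p ⟨a, rfl⟩ ⟨b, rfl⟩
      exact ⟨A * a ^ 2 + B * b ^ 2, by linear_combination -heq⟩
    · rintro ⟨rfl, rfl⟩
      have : 0 < C * w' ^ 2 := mul_pos hc.posC (by positivity)
      have : C * w' ^ 2 = 0 := by rw [← heq]; ring
      omega
  · apply isCoprime_of_sq_dvd hc.sqB (z := v') (fun p hp1 h1 h3 h2 => hp p hp1 h1 h2 h3)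
    · rintro p ⟨a, rfl⟩ ⟨b, rfl⟩
      exact ⟨C * b ^ 2 - A * a ^ 2, by linear_combination heq⟩
    · omega
  · apply isCoprime_of_sq_dvd hc.sqA (z := u') (fun p hp1 h2 h3 h1 => hp p hp1 h1 h2 h3)
    · rintro p ⟨a, rfl⟩ ⟨b, rfl⟩
      exact ⟨C * b ^ 2 - B * a ^ 2, by linear_combination heq⟩
    · omega

/-- `(u', v', w')` is a small conic point lying in the lattice of `(u, v, w)` after changing signs
on the divisors `d₁, d₂, d₃` of the coefficients. -/
structure IsReference (A B C d₁ d₂ d₃ u' v' w' : ℤ) : Prop where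
  pos₁ : 0 < d₁
  pos₂ : 0 < d₂
  pos₃ : 0 < d₃
  dvd₁ : d₁ ∣ A
  dvd₂ : d₂ ∣ B
  dvd₃ : d₃ ∣ C
  posw : 0 < w'
  point : IsConicPoint A B C u' v' w'
  small : (d₁ * d₂ * d₃ * w') ^ 2 ≤ 4 * (A * B)

/-- The point `(u, v, w)` lies in the lattice attached to `(u', v', w')` and the sign changes
`d₁, d₂, d₃`. -/
structure RefersTo (A B C d₁ d₂ d₃ u' v' w' u v w : ℤ) : Prop where
  agree₁ : AgreeUpToSign A d₁ (v * w') (w * v')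
  agree₂ : AgreeUpToSign B d₂ (u * w') (w * u')
  agree₃ : AgreeUpToSign C d₃ (u * v') (v * u')

lemma exists_reference {A B C u v w : ℤ} (hc : IsConicCoeff A B C)
    (h : IsConicPoint A B C u v w) (hw : 0 < w) :
    ∃ d₁ d₂ d₃ u' v' w' : ℤ, IsReference A B C d₁ d₂ d₃ u' v' w' ∧
      RefersTo A B C d₁ d₂ d₃ u' v' w' u v w := by
  obtain ⟨U, V, W, hW, hE, hS, hA, hB, hC⟩ := exists_small_lattice_point hc h hw
  obtain ⟨n, u', v', w', hn, hw', rfl, rfl, rfl, hp⟩ := exists_primitive hc hW hE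
  have e := h.eqn
  have e' := hp.eqn
  obtain ⟨d₁, p1, q1, r1, s1⟩ := exists_agreeUpToSign (n := n) (x := v * w') (y := w * v')
    hc.posA hc.sqA
    (hc.copAB.dvd_of_dvd_mul_left ⟨w ^ 2 * u' ^ 2 - u ^ 2 * w' ^ 2, by
      linear_combination w' ^ 2 * e - w ^ 2 * e'⟩)
    (by convert hA using 1; ring)
  obtain ⟨d₂, p2, q2, r2, s2⟩ := exists_agreeUpToSign (n := n) (x := u * w') (y := w * u')
    hc.posB hc.sqB
    (hc.copAB.symm.dvd_of_dvd_mul_left ⟨w ^ 2 * v' ^ 2 - v ^ 2 * w' ^ 2, by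
      linear_combination w' ^ 2 * e - w ^ 2 * e'⟩)
    (by convert hB using 1; ring)
  obtain ⟨d₃, p3, q3, r3, s3⟩ := exists_agreeUpToSign (n := n) (x := u * v') (y := v * u')
    hc.posC hc.sqC
    (hc.copAC.symm.dvd_of_dvd_mul_left ⟨w ^ 2 * v' ^ 2 - v ^ 2 * w' ^ 2, by
      linear_combination v' ^ 2 * e - v ^ 2 * e'⟩)
    (by convert hC using 1; ring)
  refine ⟨d₁, d₂, d₃, u', v', w', ⟨p1, p2, p3, q1, q2, q3, hw', hp, ?_⟩, s1, s2, s3⟩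
  have c12 : IsCoprime d₁ d₂ := hc.copAB.of_isCoprime_of_dvd_left q1 |>.of_isCoprime_of_dvd_right q2
  have c13 : IsCoprime d₁ d₃ := hc.copAC.of_isCoprime_of_dvd_left q1 |>.of_isCoprime_of_dvd_right q3
  have c23 : IsCoprime d₂ d₃ := hc.copBC.of_isCoprime_of_dvd_left q2 |>.of_isCoprime_of_dvd_right q3
  have hdvd : d₁ * d₂ * d₃ ∣ n :=
    (IsCoprime.mul_left c13 c23).mul_dvd (c12.mul_dvd r1 r2) r3
  have hle := Int.le_of_dvd hn hdvd
  refine le_trans ?_ hS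
  gcongr

/-- Distinct conic points with the same reference are far apart. -/
lemma mul_le_of_same_reference {A B C d₁ d₂ d₃ u' v' w' u v w x y z : ℤ}
    (hc : IsConicCoeff A B C) (hr : IsReference A B C d₁ d₂ d₃ u' v' w')
    (h : IsConicPoint A B C u v w) (g : IsConicPoint A B C x y z)
    (h1 : RefersTo A B C d₁ d₂ d₃ u' v' w' u v w) (g1 : RefersTo A B C d₁ d₂ d₃ u' v' w' x y z)
    (hu : 0 < u) (hw : 0 < w) (hx : 0 < x) (hy : 0 < y) (hz : 0 < z)
    (hne : (u, v, w) ≠ (x, y, z)) :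
    A * B * C ≤ C * w * z - A * u * x - B * v * y := by
  have hA := hc.posA
  have hB := hc.posB
  have hC := hc.posC
  have hp := hr.point
  have k1 : A ∣ v * z - w * y := h1.agree₁.dvd_sub g1.agree₁ hc.sqA (hp.cop_v_A hc) (hp.cop_w_A hc)
  have k2 : B ∣ u * z - w * x := h1.agree₂.dvd_sub g1.agree₂ hc.sqB (hp.cop_u_B hc) (hp.cop_w_B hc)
  have k3 : C ∣ u * y - v * x := h1.agree₃.dvd_sub g1.agree₃ hc.sqC (hp.cop_u_C hc) (hp.cop_v_C hc)
  have e := h.eqn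
  have l1 : A ∣ C * w * z - A * u * x - B * v * y := by
    apply (h.cop_w_A hc).symm.dvd_of_dvd_mul_left
    obtain ⟨k, hk⟩ := k1
    exact ⟨B * v * k + u ^ 2 * z - u * x * w, by linear_combination (-z) * e + B * v * hk⟩
  have l2 : B ∣ C * w * z - A * u * x - B * v * y := by
    apply (h.cop_w_B hc).symm.dvd_of_dvd_mul_left
    obtain ⟨k, hk⟩ := k2
    exact ⟨A * u * k + v ^ 2 * z - v * y * w, by linear_combination (-z) * e + A * u * hk⟩
  have l3 : C ∣ C * w * z - A * u * x - B * v * y := by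
    apply (h.cop_v_C hc).symm.dvd_of_dvd_mul_left
    obtain ⟨k, hk⟩ := k3
    exact ⟨w * z * v + A * u * k - w ^ 2 * y, by linear_combination (-y) * e + A * u * hk⟩
  have hdvd : A * B * C ∣ C * w * z - A * u * x - B * v * y :=
    (IsCoprime.mul_left hc.copAC hc.copBC).mul_dvd (hc.copAB.mul_dvd l1 l2) l3
  refine Int.le_of_dvd ?_ hdvd
  have hne' : u * y - v * x ≠ 0 := by
    intro h0
    have hux : u ∣ x := h.copuv.dvd_of_dvd_mul_left ⟨y, by linarith⟩
    have hxu : x ∣ u := g.copuv.dvd_of_dvd_mul_right ⟨v, by linarith⟩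
    have hux' : u = x := Int.dvd_antisymm hu.le hx.le hux hxu
    subst hux'
    have hvy : v = y := by
      have : u * (y - v) = 0 := by linarith
      rcases mul_eq_zero.1 this with h | h <;> omega
    subst hvy
    have hwz : w ^ 2 = z ^ 2 := mul_left_cancel₀ hC.ne' (e.symm.trans g.eqn)
    have : w = z := (pow_left_inj₀ hw.le hz.le two_ne_zero).1 hwz
    subst this
    exact hne rfl
  have hsq : (A * u * x + B * v * y) ^ 2 < (C * w * z) ^ 2 := by
    have : (C * w * z) ^ 2 - (A * u * x + B * v * y) ^ 2 = A * B * (u * y - v * x) ^ 2 := by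
      linear_combination (-(C * z ^ 2)) * e - (A * u ^ 2 + B * v ^ 2) * g.eqn
    have : 0 < A * B * (u * y - v * x) ^ 2 := by positivity
    linarith
  have := lt_of_pow_lt_pow_left₀ 2 (by positivity) hsq
  linarith

/-- A coordinate on the positive arc of the conic that separates distant points. -/
lemma arc_coordinate_separated {A B C u v w x y z W : ℝ} (hA : 0 < A) (hB : 0 < B) (hC : 0 < C)
    (hu : 0 < u) (hv : 0 < v) (hw : 0 < w) (hx : 0 < x) (hy : 0 < y) (hz : 0 < z)
    (h : A * u ^ 2 + B * v ^ 2 = C * w ^ 2) (g : A * x ^ 2 + B * y ^ 2 = C * z ^ 2)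
    (hwW : w ≤ W) (hzW : z ≤ W) (hle : A * B * C ≤ C * w * z - A * u * x - B * v * y) :
    √(2 * A * B) / W ≤
      |(√A * u - √B * v) / (√C * w) - (√A * x - √B * y) / (√C * z)| := by
  have hW : 0 < W := hw.trans_le hwW
  have a2 : √A ^ 2 = A := Real.sq_sqrt hA.le
  have b2 : √B ^ 2 = B := Real.sq_sqrt hB.le
  have c2 : √C ^ 2 = C := Real.sq_sqrt hC.le
  have a0 : 0 < √A := Real.sqrt_pos.2 hA
  have b0 : 0 < √B := Real.sqrt_pos.2 hB
  have c0 : 0 < √C := Real.sqrt_pos.2 hC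
  obtain ⟨α, hα⟩ : ∃ α, α = √A * u / (√C * w) := ⟨_, rfl⟩
  obtain ⟨β, hβ⟩ : ∃ β, β = √B * v / (√C * w) := ⟨_, rfl⟩
  obtain ⟨α', hα'⟩ : ∃ α', α' = √A * x / (√C * z) := ⟨_, rfl⟩
  obtain ⟨β', hβ'⟩ : ∃ β', β' = √B * y / (√C * z) := ⟨_, rfl⟩
  have α0 : 0 < α := by rw [hα]; positivity
  have β0 : 0 < β := by rw [hβ]; positivity
  have α0' : 0 < α' := by rw [hα']; positivity
  have β0' : 0 < β' := by rw [hβ']; positivity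
  have e1 : α ^ 2 + β ^ 2 = 1 := by
    rw [hα, hβ, div_pow, div_pow, mul_pow, mul_pow, mul_pow, a2, b2, c2, ← add_div, h]
    exact div_self (by positivity)
  have e2 : α' ^ 2 + β' ^ 2 = 1 := by
    rw [hα', hβ', div_pow, div_pow, mul_pow, mul_pow, mul_pow, a2, b2, c2, ← add_div, g]
    exact div_self (by positivity)
  have e3 : α * α' + β * β' = (A * u * x + B * v * y) / (C * w * z) := by
    rw [hα, hα', hβ, hβ', div_mul_div_comm, div_mul_div_comm,
      show √C * w * (√C * z) = √C ^ 2 * w * z by ring, c2, ← add_div]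
    congr 1
    linear_combination u * x * a2 + v * y * b2
  have e4 : α * α' + β * β' ≤ 1 - A * B / W ^ 2 := by
    have h1 : A * B / W ^ 2 ≤ A * B / (w * z) := by
      gcongr
      rw [sq]; gcongr
    have h2 : α * α' + β * β' ≤ 1 - A * B / (w * z) := by
      rw [e3, div_le_iff₀ (by positivity)]
      have : (1 - A * B / (w * z)) * (C * w * z) = C * w * z - A * B * C := by
        field_simp
      linarith
    linarith
  have e5 : (α - α') * (β - β') ≤ 0 := by
    by_contra! hpos
    have h1 : (α - α') * (α + α') = -((β - β') * (β + β')) := by linear_combination e1 - e2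
    have h2 : 0 < (α - α') * (β - β') * (α + α') := by positivity
    have h3 : (α - α') * (β - β') * (α + α') = -((β - β') ^ 2 * (β + β')) := by
      linear_combination (β - β') * h1
    have h4 : 0 ≤ (β - β') ^ 2 * (β + β') := by positivity
    linarith
  have e6 : (√A * u - √B * v) / (√C * w) - (√A * x - √B * y) / (√C * z)
      = α - β - (α' - β') := by
    rw [hα, hβ, hα', hβ']; ring
  have e7 : (√(2 * A * B) / W) ^ 2 ≤ (α - β - (α' - β')) ^ 2 := by
    rw [div_pow, Real.sq_sqrt (by positivity)]
    have : 2 * A * B / W ^ 2 = 2 * (A * B / W ^ 2) := by ring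
    nlinarith
  rw [e6]
  have := sq_le_sq.1 e7
  rwa [abs_of_nonneg (by positivity)] at this

lemma card_same_reference_le {A B C d₁ d₂ d₃ u' v' w' : ℤ} {W : ℝ} (hW : 0 < W)
    (hc : IsConicCoeff A B C) (hr : IsReference A B C d₁ d₂ d₃ u' v' w')
    (s : Finset (ℤ × ℤ × ℤ)) (hs : ∀ p ∈ s, 0 < p.1 ∧ 0 < p.2.1 ∧ 0 < p.2.2 ∧
      IsConicPoint A B C p.1 p.2.1 p.2.2 ∧ (p.2.2 : ℝ) ≤ W ∧
      RefersTo A B C d₁ d₂ d₃ u' v' w' p.1 p.2.1 p.2.2) :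
    (s.card : ℝ) ≤ 1 + 2 / (√(2 * A * B) / W) := by
  have hA : (0 : ℝ) < A := by exact_mod_cast hc.posA
  have hB : (0 : ℝ) < B := by exact_mod_cast hc.posB
  have hC : (0 : ℝ) < C := by exact_mod_cast hc.posC
  apply card_le_of_separated s
    (fun p => (√(A : ℝ) * p.1 - √(B : ℝ) * p.2.1) / (√(C : ℝ) * p.2.2)) (a := -1)
    (by positivity) (by norm_num)
  · rintro ⟨u, v, w⟩ hp
    obtain ⟨hu, hv, hw, h, -, -⟩ := hs _ hp
    have hu' : (0 : ℝ) < u := by exact_mod_cast hu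
    have hv' : (0 : ℝ) < v := by exact_mod_cast hv
    have hw' : (0 : ℝ) < w := by exact_mod_cast hw
    have heq : (A : ℝ) * u ^ 2 + B * v ^ 2 = C * w ^ 2 := by exact_mod_cast h.eqn
    have h1 : √(A : ℝ) * u ≤ √(C : ℝ) * w := by
      rw [← abs_of_pos (show 0 < √(A : ℝ) * u by positivity),
        ← abs_of_pos (show 0 < √(C : ℝ) * w by positivity), ← sq_le_sq, mul_pow, mul_pow,
        Real.sq_sqrt hA.le, Real.sq_sqrt hC.le]
      have : 0 < (B : ℝ) * v ^ 2 := by positivity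
      linarith
    have h2 : √(B : ℝ) * v ≤ √(C : ℝ) * w := by
      rw [← abs_of_pos (show 0 < √(B : ℝ) * v by positivity),
        ← abs_of_pos (show 0 < √(C : ℝ) * w by positivity), ← sq_le_sq, mul_pow, mul_pow,
        Real.sq_sqrt hB.le, Real.sq_sqrt hC.le]
      have : 0 < (A : ℝ) * u ^ 2 := by positivity
      linarith
    have h3 : 0 < √(A : ℝ) * u := by positivity
    have h4 : 0 < √(B : ℝ) * v := by positivity
    have h5 : 0 < √(C : ℝ) * w := by positivity
    constructor
    · rw [le_div_iff₀ h5]; linarith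
    · rw [div_le_iff₀ h5]; linarith
  · rintro ⟨u, v, w⟩ hp ⟨x, y, z⟩ hq hne
    obtain ⟨hu, hv, hw, h, hwW, hl⟩ := hs _ hp
    obtain ⟨hx, hy, hz, g, hzW, gl⟩ := hs _ hq
    have hle := mul_le_of_same_reference hc hr h g hl gl hu hw hx hy hz hne
    dsimp only at *
    apply arc_coordinate_separated hA hB hC (by exact_mod_cast hu) (by exact_mod_cast hv)
      (by exact_mod_cast hw) (by exact_mod_cast hx) (by exact_mod_cast hy) (by exact_mod_cast hz)
      (by exact_mod_cast h.eqn) (by exact_mod_cast g.eqn) hwW hzW (by exact_mod_cast hle)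

/-- Few pairs of coprime positive integers in a dyadic box have all their determinants divisible
by `q`. -/
lemma card_le_of_dvd_det {ι : Type*} (s : Finset ι) (f g : ι → ℤ) {P Q q : ℝ} (hP : 0 < P)
    (hQ : 0 < Q) (hq : 0 < q)
    (hs : ∀ x ∈ s, P ≤ f x ∧ f x ≤ 2 * P ∧ 0 ≤ (g x : ℝ) ∧ g x ≤ 2 * Q)
    (hdet : ∀ x ∈ s, ∀ y ∈ s, x ≠ y → q ≤ |((f x * g y - f y * g x : ℤ) : ℝ)|) :
    (s.card : ℝ) ≤ 1 + 8 * P * Q / q := by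
  have key := card_le_of_separated s (fun x => (g x : ℝ) / f x) (a := 0) (l := 2 * Q / P)
    (δ := q / (4 * P ^ 2)) (by positivity) (by positivity) ?_ ?_
  · convert key using 2
    field_simp
    ring
  · intro x hx
    obtain ⟨h1, h2, h3, h4⟩ := hs x hx
    have : (0 : ℝ) < f x := hP.trans_le h1
    refine ⟨by positivity, ?_⟩
    rw [zero_add]
    gcongr
  · intro x hx y hy hne
    obtain ⟨h1, h2, h3, h4⟩ := hs x hx
    obtain ⟨k1, k2, k3, k4⟩ := hs y hy
    have fx : (0 : ℝ) < f x := hP.trans_le h1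
    have fy : (0 : ℝ) < f y := hP.trans_le k1
    have hd := hdet x hx y hy hne
    have : (g x : ℝ) / f x - g y / f y = -((f x * g y - f y * g x : ℤ) : ℝ) / (f x * f y) := by
      push_cast
      field_simp
      ring
    rw [this, abs_div, abs_neg, abs_of_pos (mul_pos fx fy)]
    apply div_le_div₀ (abs_nonneg _) hd (mul_pos fx fy)
    nlinarith

lemma dvd_det_of_reference {A B C A' B' C' d₁ d₂ d₃ u v w : ℤ}
    (hc : IsConicCoeff A B C)
    (h : IsReference A B C d₁ d₂ d₃ u v w) (h' : IsReference A' B' C' d₁ d₂ d₃ u v w) :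
    d₁ * d₂ * (d₃ * w ^ 2) ∣ A * B' - A' * B := by
  have cAB : IsCoprime d₁ d₂ :=
    hc.copAB.of_isCoprime_of_dvd_left h.dvd₁ |>.of_isCoprime_of_dvd_right h.dvd₂
  have cAC : IsCoprime d₁ d₃ :=
    hc.copAC.of_isCoprime_of_dvd_left h.dvd₁ |>.of_isCoprime_of_dvd_right h.dvd₃
  have cBC : IsCoprime d₂ d₃ :=
    hc.copBC.of_isCoprime_of_dvd_left h.dvd₂ |>.of_isCoprime_of_dvd_right h.dvd₃
  have cwA : IsCoprime d₁ w := (h.point.cop_w_A hc).symm.of_isCoprime_of_dvd_left h.dvd₁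
  have cwB : IsCoprime d₂ w := (h.point.cop_w_B hc).symm.of_isCoprime_of_dvd_left h.dvd₂
  have e := h.point.eqn
  have e' := h'.point.eqn
  obtain ⟨a, ha⟩ := h.dvd₁
  obtain ⟨a', ha'⟩ := h'.dvd₁
  obtain ⟨b, hb⟩ := h.dvd₂
  obtain ⟨b', hb'⟩ := h'.dvd₂
  obtain ⟨c, hc3⟩ := h.dvd₃
  obtain ⟨c', hc3'⟩ := h'.dvd₃
  apply IsCoprime.mul_dvd
  · exact IsCoprime.mul_left (IsCoprime.mul_right cAC (IsCoprime.pow_right cwA))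
      (IsCoprime.mul_right cBC (IsCoprime.pow_right cwB))
  · exact ⟨a * b' - a' * b, by rw [ha, ha', hb, hb']; ring⟩
  · have hv : IsCoprime (d₃ * w ^ 2) (v ^ 2) :=
      IsCoprime.mul_left
        ((h.point.cop_v_C hc).symm.of_isCoprime_of_dvd_left h.dvd₃ |>.pow_right)
        (IsCoprime.pow h.point.copvw.symm)
    apply hv.dvd_of_dvd_mul_left
    exact ⟨A * c' - A' * c, by
      linear_combination A * e' - A' * e + A * w ^ 2 * hc3' - A' * w ^ 2 * hc3⟩

lemma card_le_sum_of_card_fiber_le {α β : Type*} [DecidableEq β] (s : Finset α) (t : Finset β)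
    (f : α → β) (n : β → ℝ) (hf : ∀ a ∈ s, f a ∈ t)
    (hn : ∀ b ∈ t, ((s.filter (fun a => f a = b)).card : ℝ) ≤ n b) :
    (s.card : ℝ) ≤ ∑ b ∈ t, n b := by
  rw [Finset.card_eq_sum_card_fiberwise hf, Nat.cast_sum]
  exact Finset.sum_le_sum hn

lemma card_coeff_le {d₁ d₂ d₃ u v w : ℤ} {P Q : ℝ} (hP : 0 < P) (hQ : 0 < Q)
    (s : Finset (ℤ × ℤ × ℤ))
    (hs : ∀ x ∈ s, IsConicCoeff x.1 x.2.1 x.2.2 ∧ IsReference x.1 x.2.1 x.2.2 d₁ d₂ d₃ u v w ∧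
      P ≤ x.1 ∧ x.1 ≤ 2 * P ∧ Q ≤ x.2.1 ∧ x.2.1 ≤ 2 * Q) :
    (s.card : ℝ) ≤ 24 * P * Q / |(d₁ * d₂ * d₃ * w ^ 2 : ℝ)| := by
  rcases s.eq_empty_or_nonempty with rfl | ⟨x₀, hx₀⟩
  · simp only [Finset.card_empty, Nat.cast_zero]; positivity
  obtain ⟨hc, hr, hP1, hP2, hQ1, hQ2⟩ := hs _ hx₀
  have h1 : (1 : ℝ) ≤ d₁ := by exact_mod_cast hr.pos₁
  have h2 : (1 : ℝ) ≤ d₂ := by exact_mod_cast hr.pos₂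
  have h3 : (1 : ℝ) ≤ d₃ := by exact_mod_cast hr.pos₃
  have hw : (1 : ℝ) ≤ w := by exact_mod_cast hr.posw
  set q : ℝ := d₁ * d₂ * d₃ * w ^ 2 with hq
  have hq0 : 0 < q := by positivity
  rw [abs_of_pos hq0]
  have key : (s.card : ℝ) ≤ 1 + 8 * P * Q / q := by
    apply card_le_of_dvd_det s (fun x => x.1) (fun x => x.2.1) hP hQ hq0
    · intro x hx
      obtain ⟨-, -, k1, k2, k3, k4⟩ := hs _ hx
      exact ⟨k1, k2, hQ.le.trans k3, k4⟩
    · rintro ⟨A, B, C⟩ hx ⟨A', B', C'⟩ hy hne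
      obtain ⟨kc, kr, -⟩ := hs _ hx
      obtain ⟨lc, lr, -⟩ := hs _ hy
      dsimp only at *
      have hd := dvd_det_of_reference kc kr lr
      have hne0 : A * B' - A' * B ≠ 0 := by
        intro h0
        apply hne
        have hA : A ∣ A' := kc.copAB.dvd_of_dvd_mul_right ⟨B', by linarith⟩
        have hA' : A' ∣ A := lc.copAB.dvd_of_dvd_mul_right ⟨B, by linarith⟩
        obtain rfl := Int.dvd_antisymm kc.posA.le lc.posA.le hA hA'
        obtain rfl : B = B' := mul_left_cancel₀ kc.posA.ne' (by linarith)
        have hw2 : w ^ 2 ≠ 0 := pow_ne_zero 2 hr.posw.ne'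
        obtain rfl : C = C' :=
          mul_right_cancel₀ hw2 (kr.point.eqn.symm.trans lr.point.eqn)
        rfl
      have hle : |d₁ * d₂ * (d₃ * w ^ 2)| ≤ |A * B' - A' * B| :=
        Int.le_of_dvd (abs_pos.2 hne0) ((abs_dvd_abs _ _).2 hd)
      have hle' : ((|d₁ * d₂ * (d₃ * w ^ 2)| : ℤ) : ℝ) ≤ (|A * B' - A' * B| : ℤ) := by
        exact_mod_cast hle
      rw [Int.cast_abs, Int.cast_abs] at hle'
      refine le_trans ?_ hle'
      rw [← abs_of_pos hq0, hq]
      apply le_of_eq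
      push_cast
      congr 1
      ring
  have hone : 1 ≤ 16 * P * Q / q := by
    rw [one_le_div hq0]
    have hsm : ((d₁ * d₂ * d₃ * w : ℝ)) ^ 2 ≤ 4 * (x₀.1 * x₀.2.1) := by exact_mod_cast hr.small
    have hd : (1 : ℝ) ≤ d₁ * d₂ * d₃ := one_le_mul_of_one_le_of_one_le
      (one_le_mul_of_one_le_of_one_le h1 h2) h3
    calc q ≤ (d₁ * d₂ * d₃) * q := le_mul_of_one_le_left hq0.le hd
      _ = (d₁ * d₂ * d₃ * w : ℝ) ^ 2 := by rw [hq]; ring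
      _ ≤ 4 * (x₀.1 * x₀.2.1) := hsm
      _ ≤ 4 * ((2 * P) * (2 * Q)) := by
        have : (0 : ℝ) ≤ x₀.2.1 := hQ.le.trans hQ1
        gcongr
      _ = 16 * P * Q := by ring
  calc (s.card : ℝ) ≤ 16 * P * Q / q + 8 * P * Q / q := by linarith
    _ = 24 * P * Q / q := by ring

lemma card_nonzero_le (s : Finset ℤ) {U : ℝ} (hU : 0 ≤ U)
    (hs : ∀ u ∈ s, u ≠ 0 ∧ (u : ℝ) ^ 2 ≤ U ^ 2) : (s.card : ℝ) ≤ 2 * U := by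
  have hsub : s ⊆ (Finset.Icc (-⌊U⌋) ⌊U⌋).erase 0 := by
    intro u hu
    obtain ⟨h0, h1⟩ := hs u hu
    have h2 := abs_le.1 (abs_le_of_sq_le_sq h1 hU)
    rw [Finset.mem_erase, Finset.mem_Icc]
    refine ⟨h0, ?_, Int.le_floor.2 h2.2⟩
    have : -u ≤ ⌊U⌋ := Int.le_floor.2 (by push_cast; linarith)
    omega
  have hf : 0 ≤ ⌊U⌋ := Int.floor_nonneg.2 hU
  have hc := Finset.card_le_card hsub
  rw [Finset.card_erase_of_mem (by rw [Finset.mem_Icc]; omega), Int.card_Icc] at hc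
  have h1 : (s.card : ℤ) ≤ 2 * ⌊U⌋ := by omega
  have h2 : (s.card : ℝ) ≤ 2 * ⌊U⌋ := by exact_mod_cast h1
  linarith [Int.floor_le U]

/-- Coefficients together with a reference: `((A, B, C), (d₁, d₂, d₃), (u, v, w))`. -/
abbrev RefTuple : Type := (ℤ × ℤ × ℤ) × (ℤ × ℤ × ℤ) × (ℤ × ℤ × ℤ)

/-- The conditions on a reference tuple. -/
def IsRefTuple (r : RefTuple) : Prop :=
  IsConicCoeff r.1.1 r.1.2.1 r.1.2.2 ∧
    IsReference r.1.1 r.1.2.1 r.1.2.2 r.2.1.1 r.2.1.2.1 r.2.1.2.2 r.2.2.1 r.2.2.2.1 r.2.2.2.2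

/-- The coefficients of the reference tuple lie in the box `[P, 2 P] × [Q, 2 Q] × [R, 2 R]`. -/
def InBox (P Q R : ℝ) (r : RefTuple) : Prop :=
  (P ≤ r.1.1 ∧ r.1.1 ≤ 2 * P) ∧ (Q ≤ r.1.2.1 ∧ r.1.2.1 ≤ 2 * Q) ∧
    (R ≤ r.1.2.2 ∧ r.1.2.2 ≤ 2 * R)

lemma card_refTuple_fixed_le {P Q R : ℝ} (hP : 0 < P) (hQ : 0 < Q) (hR : 0 < R)
    {d₁ d₂ d₃ w : ℤ} (h1 : 0 < d₁) (h2 : 0 < d₂) (h3 : 0 < d₃) (hw : 0 < w)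
    (s : Finset RefTuple)
    (hs : ∀ r ∈ s, IsRefTuple r ∧ InBox P Q R r ∧ r.2.2.1 ≠ 0 ∧ r.2.2.2.1 ≠ 0 ∧
      r.2.1 = (d₁, d₂, d₃) ∧ r.2.2.2.2 = w) :
    (s.card : ℝ) ≤ 192 * √(P * Q) * R / (d₁ * d₂ * d₃) := by
  classical
  have h1' : (0 : ℝ) < d₁ := by exact_mod_cast h1
  have h2' : (0 : ℝ) < d₂ := by exact_mod_cast h2
  have h3' : (0 : ℝ) < d₃ := by exact_mod_cast h3
  have hw' : (0 : ℝ) < w := by exact_mod_cast hw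
  set U : ℝ := w * √(2 * R / P) with hU
  set V : ℝ := w * √(2 * R / Q) with hV
  have hU2 : U ^ 2 = w ^ 2 * (2 * R / P) := by rw [hU, mul_pow, Real.sq_sqrt (by positivity)]
  have hV2 : V ^ 2 = w ^ 2 * (2 * R / Q) := by rw [hV, mul_pow, Real.sq_sqrt (by positivity)]
  have hU0 : 0 ≤ U := by positivity
  have hV0 : 0 ≤ V := by positivity
  set tu := s.image (fun r => r.2.2.1) with htu
  set tv := s.image (fun r => r.2.2.2.1) with htv
  have hbound : ∀ r ∈ s, (r.2.2.1 : ℝ) ^ 2 ≤ U ^ 2 ∧ (r.2.2.2.1 : ℝ) ^ 2 ≤ V ^ 2 := by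
    rintro ⟨⟨A, B, C⟩, ⟨e1, e2, e3⟩, ⟨u, v, w'⟩⟩ hr
    obtain ⟨⟨-, hr⟩, ⟨⟨a1, a2⟩, ⟨b1, b2⟩, ⟨c1, c2⟩⟩, -, -, -, hww⟩ := hs _ hr
    dsimp only at *
    subst hww
    have heq : (A : ℝ) * u ^ 2 + B * v ^ 2 = C * w' ^ 2 := by exact_mod_cast hr.point.eqn
    have hA : (0 : ℝ) < A := hP.trans_le a1
    have hB : (0 : ℝ) < B := hQ.trans_le b1
    rw [hU2, hV2]
    have hCw : (C : ℝ) * w' ^ 2 ≤ 2 * R * w' ^ 2 := by gcongr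
    constructor
    · have e : (w' : ℝ) ^ 2 * (2 * R / P) = 2 * R * w' ^ 2 / P := by ring
      rw [e, le_div_iff₀ hP]
      have : P * (u : ℝ) ^ 2 ≤ A * u ^ 2 := by gcongr
      have : 0 ≤ (B : ℝ) * v ^ 2 := by positivity
      linarith
    · have e : (w' : ℝ) ^ 2 * (2 * R / Q) = 2 * R * w' ^ 2 / Q := by ring
      rw [e, le_div_iff₀ hQ]
      have : Q * (v : ℝ) ^ 2 ≤ B * v ^ 2 := by gcongr
      have : 0 ≤ (A : ℝ) * u ^ 2 := by positivity
      linarith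
  have htuc : (tu.card : ℝ) ≤ 2 * U := by
    apply card_nonzero_le _ hU0
    intro u hu
    obtain ⟨r, hr, rfl⟩ := Finset.mem_image.1 hu
    exact ⟨(hs r hr).2.2.1, (hbound r hr).1⟩
  have htvc : (tv.card : ℝ) ≤ 2 * V := by
    apply card_nonzero_le _ hV0
    intro v hv
    obtain ⟨r, hr, rfl⟩ := Finset.mem_image.1 hv
    exact ⟨(hs r hr).2.2.2.1, (hbound r hr).2⟩
  have hUV : U * V * √(P * Q) = 2 * R * w ^ 2 := by
    have : (U * V * √(P * Q)) ^ 2 = (2 * R * w ^ 2) ^ 2 := by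
      rw [mul_pow, mul_pow, hU2, hV2, Real.sq_sqrt (by positivity)]
      field_simp
    exact (pow_left_inj₀ (by positivity) (by positivity) two_ne_zero).1 this
  have hPQ : √(P * Q) ^ 2 = P * Q := Real.sq_sqrt (by positivity)
  have key := card_le_sum_of_card_fiber_le s (tu ×ˢ tv) (fun r => (r.2.2.1, r.2.2.2.1))
    (fun _ => 24 * P * Q / |(d₁ * d₂ * d₃ * w ^ 2 : ℝ)|)
    (fun r hr => Finset.mem_product.2
      ⟨Finset.mem_image_of_mem _ hr, Finset.mem_image_of_mem _ hr⟩) (by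
      rintro ⟨u, v⟩ -
      rw [← Finset.card_image_of_injOn (f := fun r : RefTuple => r.1)]
      · apply card_coeff_le hP hQ (u := u) (v := v)
        intro x hx
        obtain ⟨r, hr, rfl⟩ := Finset.mem_image.1 hx
        obtain ⟨hr, huv⟩ := Finset.mem_filter.1 hr
        obtain ⟨⟨hc, hr⟩, ⟨⟨a1, a2⟩, ⟨b1, b2⟩, -⟩, -, -, hd, hww⟩ := hs _ hr
        obtain ⟨hu, hv⟩ := Prod.mk.inj huv
        rw [hd, hu, hv, hww] at hr
        exact ⟨hc, hr, a1, a2, b1, b2⟩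
      · intro r hr r' hr' hrr
        obtain ⟨hr, huv⟩ := Finset.mem_filter.1 hr
        obtain ⟨hr', huv'⟩ := Finset.mem_filter.1 hr'
        obtain ⟨-, -, -, -, hd, hww⟩ := hs _ hr
        obtain ⟨-, -, -, -, hd', hww'⟩ := hs _ hr'
        obtain ⟨hu, hv⟩ := Prod.mk.inj (huv.trans huv'.symm)
        exact Prod.ext hrr (Prod.ext (hd.trans hd'.symm)
          (Prod.ext hu (Prod.ext hv (hww.trans hww'.symm)))))
  rw [Finset.sum_const, Finset.card_product, nsmul_eq_mul, Nat.cast_mul] at key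
  refine key.trans ?_
  rw [abs_of_pos (by positivity)]
  calc (tu.card : ℝ) * tv.card * (24 * P * Q / (d₁ * d₂ * d₃ * w ^ 2))
      ≤ (2 * U) * (2 * V) * (24 * P * Q / (d₁ * d₂ * d₃ * w ^ 2)) := by gcongr
    _ = 192 * √(P * Q) * R / (d₁ * d₂ * d₃) := by
      rw [mul_div_assoc', div_eq_div_iff (by positivity) (by positivity)]
      linear_combination (-96 * U * V * (d₁ * d₂ * d₃)) * hPQ
        + 96 * √(P * Q) * (d₁ * d₂ * d₃) * hUV

lemma sum_inv_sq_le (N : ℕ) : ∑ d ∈ Finset.Icc (1 : ℤ) N, 1 / (d : ℝ) ^ 2 ≤ 2 := by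
  suffices h : ∑ d ∈ Finset.Icc (1 : ℤ) N, 1 / (d : ℝ) ^ 2 ≤ 2 - 1 / (N : ℝ) by
    have : (0 : ℝ) ≤ 1 / (N : ℝ) := by positivity
    linarith
  induction N with
  | zero => simp
  | succ n ih =>
    have e : Finset.Icc (1 : ℤ) ((n + 1 : ℕ) : ℤ)
        = insert ((n : ℤ) + 1) (Finset.Icc (1 : ℤ) n) := by
      ext x; simp only [Finset.mem_Icc, Finset.mem_insert]; push_cast; omega
    rw [e, Finset.sum_insert (by simp)]
    push_cast
    rcases n.eq_zero_or_pos with rfl | hn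
    · norm_num
    have hn' : (0 : ℝ) < n := by exact_mod_cast hn
    have hstep : 1 / ((n : ℝ) + 1) ^ 2 ≤ 1 / n - 1 / (n + 1) := by
      rw [div_sub_div _ _ hn'.ne' (by positivity)]
      apply div_le_div₀ <;> nlinarith
    linarith

lemma sum_inv_le (N : ℕ) : ∑ d ∈ Finset.Icc (1 : ℤ) N, 1 / (d : ℝ) ≤ 1 + Real.log N := by
  induction N with
  | zero => simp
  | succ n ih =>
    have e : Finset.Icc (1 : ℤ) ((n + 1 : ℕ) : ℤ)
        = insert ((n : ℤ) + 1) (Finset.Icc (1 : ℤ) n) := by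
      ext x; simp only [Finset.mem_Icc, Finset.mem_insert]; push_cast; omega
    rw [e, Finset.sum_insert (by simp)]
    rcases n.eq_zero_or_pos with rfl | hn
    · simp
    have hn' : (0 : ℝ) < n := by exact_mod_cast hn
    have h := Real.one_sub_inv_le_log_of_pos (x := ((n : ℝ) + 1) / n) (by positivity)
    rw [Real.log_div (by positivity) (by positivity)] at h
    have e2 : 1 - (((n : ℝ) + 1) / n)⁻¹ = 1 / (n + 1) := by field_simp; ring
    push_cast
    linarith

lemma card_refTuple_fixed_divisors_le {P Q R : ℝ} (hP : 0 < P) (hQ : 0 < Q) (hR : 0 < R)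
    {d₁ d₂ d₃ : ℤ} (h1 : 0 < d₁) (h2 : 0 < d₂) (h3 : 0 < d₃) (s : Finset RefTuple)
    (hs : ∀ r ∈ s, IsRefTuple r ∧ InBox P Q R r ∧ r.2.2.1 ≠ 0 ∧ r.2.2.2.1 ≠ 0 ∧
      r.2.1 = (d₁, d₂, d₃)) :
    (s.card : ℝ) ≤ 768 * P * Q * R *
      (1 / (d₁ : ℝ) ^ 2 * (1 / (d₂ : ℝ) ^ 2 * (1 / (d₃ : ℝ) ^ 2))) := by
  have h1' : (0 : ℝ) < d₁ := by exact_mod_cast h1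
  have h2' : (0 : ℝ) < d₂ := by exact_mod_cast h2
  have h3' : (0 : ℝ) < d₃ := by exact_mod_cast h3
  have hPQ : √(P * Q) ^ 2 = P * Q := Real.sq_sqrt (by positivity)
  set M : ℝ := 4 * √(P * Q) / (d₁ * d₂ * d₃) with hM
  have hM0 : 0 ≤ M := by positivity
  have key := card_le_sum_of_card_fiber_le s (Finset.Icc 1 ⌊M⌋) (fun r => r.2.2.2.2)
    (fun _ => 192 * √(P * Q) * R / (d₁ * d₂ * d₃)) (by
      rintro ⟨⟨A, B, C⟩, ⟨e1, e2, e3⟩, ⟨u, v, w⟩⟩ hr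
      obtain ⟨⟨-, hr⟩, ⟨⟨a1, a2⟩, ⟨b1, b2⟩, -⟩, -, -, hd⟩ := hs _ hr
      dsimp only at *
      simp only [Prod.mk.injEq] at hd
      obtain ⟨rfl, rfl, rfl⟩ := hd
      have hw : (0 : ℝ) < w := by exact_mod_cast hr.posw
      have hB : (0 : ℝ) ≤ B := hQ.le.trans b1
      refine Finset.mem_Icc.2 ⟨hr.posw, Int.le_floor.2 ?_⟩
      rw [hM, le_div_iff₀ (by positivity)]
      have hsm : (e1 * e2 * e3 * w : ℝ) ^ 2 ≤ 4 * (A * B) := by exact_mod_cast hr.small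
      refine (pow_le_pow_iff_left₀ (by positivity) (by positivity) two_ne_zero).1 ?_
      calc ((w : ℝ) * (e1 * e2 * e3)) ^ 2 = (e1 * e2 * e3 * w : ℝ) ^ 2 := by ring
        _ ≤ 4 * ((A : ℝ) * B) := hsm
        _ ≤ 4 * ((2 * P) * (2 * Q)) := by gcongr
        _ = (4 * √(P * Q)) ^ 2 := by rw [mul_pow, hPQ]; ring) (by
      intro w hw
      apply card_refTuple_fixed_le hP hQ hR h1 h2 h3 (Finset.mem_Icc.1 hw).1
      intro r hr
      obtain ⟨hr, hww⟩ := Finset.mem_filter.1 hr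
      obtain ⟨k1, k2, k3, k4, k5⟩ := hs _ hr
      exact ⟨k1, k2, k3, k4, k5, hww⟩)
  rw [Finset.sum_const, Int.card_Icc, nsmul_eq_mul] at key
  have hfl : (((⌊M⌋ + 1 - 1).toNat : ℕ) : ℝ) ≤ M := by
    have h0 : 0 ≤ ⌊M⌋ := Int.floor_nonneg.2 hM0
    rw [add_sub_cancel_right]
    have : ((⌊M⌋.toNat : ℕ) : ℝ) = ((⌊M⌋.toNat : ℤ) : ℝ) := by norm_cast
    rw [this, Int.toNat_of_nonneg h0]
    exact Int.floor_le M
  calc (s.card : ℝ) ≤ M * (192 * √(P * Q) * R / (d₁ * d₂ * d₃)) := by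
        refine key.trans ?_
        gcongr
    _ = 768 * √(P * Q) ^ 2 * R * (1 / (d₁ : ℝ) ^ 2 * (1 / (d₂ : ℝ) ^ 2 * (1 / (d₃ : ℝ) ^ 2))) := by
        rw [hM]
        field_simp
        ring
    _ = _ := by rw [hPQ]; ring

lemma card_refTuple_box_le {P Q R : ℝ} (hP : 0 < P) (hQ : 0 < Q) (hR : 0 < R) (N : ℕ)
    (s : Finset RefTuple)
    (hs : ∀ r ∈ s, IsRefTuple r ∧ InBox P Q R r ∧ r.2.2.1 ≠ 0 ∧ r.2.2.2.1 ≠ 0 ∧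
      r.1.1 ≤ N ∧ r.1.2.1 ≤ N ∧ r.1.2.2 ≤ N) :
    (s.card : ℝ) ≤ 6144 * (P * Q * R) := by
  set D := Finset.Icc (1 : ℤ) N with hD
  have key := card_le_sum_of_card_fiber_le s (D ×ˢ (D ×ˢ D)) (fun r => r.2.1)
    (fun d => 768 * P * Q * R *
      (1 / (d.1 : ℝ) ^ 2 * (1 / (d.2.1 : ℝ) ^ 2 * (1 / (d.2.2 : ℝ) ^ 2)))) (by
      intro r hr
      obtain ⟨⟨hc, hr⟩, -, -, -, k1, k2, k3⟩ := hs _ hr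
      simp only [hD, Finset.mem_product, Finset.mem_Icc]
      exact ⟨⟨hr.pos₁, (Int.le_of_dvd hc.posA hr.dvd₁).trans k1⟩,
        ⟨hr.pos₂, (Int.le_of_dvd hc.posB hr.dvd₂).trans k2⟩,
        ⟨hr.pos₃, (Int.le_of_dvd hc.posC hr.dvd₃).trans k3⟩⟩) (by
      rintro ⟨d₁, d₂, d₃⟩ hd
      simp only [hD, Finset.mem_product, Finset.mem_Icc] at hd
      obtain ⟨⟨h1, -⟩, ⟨h2, -⟩, h3, -⟩ := hd
      refine card_refTuple_fixed_divisors_le (d₁ := d₁) (d₂ := d₂) (d₃ := d₃) hP hQ hR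
        h1 h2 h3 _ ?_
      intro r hr
      obtain ⟨hr, hdd⟩ := Finset.mem_filter.1 hr
      obtain ⟨k1, k2, k3, k4, -⟩ := hs _ hr
      exact ⟨k1, k2, k3, k4, hdd⟩)
  have hsum : ∑ d ∈ D ×ˢ (D ×ˢ D), 768 * P * Q * R *
      (1 / (d.1 : ℝ) ^ 2 * (1 / (d.2.1 : ℝ) ^ 2 * (1 / (d.2.2 : ℝ) ^ 2)))
      = 768 * P * Q * R * ((∑ d ∈ D, 1 / (d : ℝ) ^ 2) *
        ((∑ d ∈ D, 1 / (d : ℝ) ^ 2) * ∑ d ∈ D, 1 / (d : ℝ) ^ 2)) := by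
    rw [← Finset.mul_sum, Finset.sum_mul_sum D D, ← Finset.sum_product', Finset.sum_mul_sum,
      ← Finset.sum_product']
  rw [hsum] at key
  have h2 := sum_inv_sq_le N
  have h0 : 0 ≤ ∑ d ∈ D, 1 / (d : ℝ) ^ 2 := Finset.sum_nonneg fun _ _ => by positivity
  calc (s.card : ℝ) ≤ 768 * P * Q * R * (2 * (2 * 2)) := by
        refine key.trans ?_
        gcongr
    _ = 6144 * (P * Q * R) := by ring

/-- The weight `1 / (A B C)` of a reference tuple. -/
noncomputable def RefTuple.weight (r : RefTuple) : ℝ := 1 / ((r.1.1 : ℝ) * r.1.2.1 * r.1.2.2)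

lemma pow_log_toNat_le {A : ℤ} (hA : 0 < A) :
    (2 : ℝ) ^ Nat.log 2 A.toNat ≤ A ∧ (A : ℝ) ≤ 2 * 2 ^ Nat.log 2 A.toNat := by
  have h0 : A.toNat ≠ 0 := by omega
  have h1 := Nat.pow_log_le_self 2 h0
  have h2 := Nat.lt_pow_succ_log_self (b := 2) (by norm_num) A.toNat
  have e : (A : ℝ) = (A.toNat : ℝ) := by
    have : (A.toNat : ℤ) = A := Int.toNat_of_nonneg hA.le
    exact_mod_cast this.symm
  rw [e]
  constructor
  · exact_mod_cast h1
  · rw [← pow_succ']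
    exact_mod_cast h2.le

lemma sum_weight_nonzero_le (N : ℕ) (s : Finset RefTuple)
    (hs : ∀ r ∈ s, IsRefTuple r ∧ r.2.2.1 ≠ 0 ∧ r.2.2.2.1 ≠ 0 ∧
      r.1.1 ≤ N ∧ r.1.2.1 ≤ N ∧ r.1.2.2 ≤ N) :
    ∑ r ∈ s, r.weight ≤ 6144 * ((Nat.log 2 N : ℝ) + 1) ^ 3 := by
  set L := Finset.range (Nat.log 2 N + 1) with hL
  set lg : ℤ → ℕ := fun A => Nat.log 2 A.toNat with hlg
  have hmem : ∀ A : ℤ, A ≤ N → lg A ∈ L := by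
    intro A hA
    rw [hL, Finset.mem_range, Nat.lt_succ_iff]
    exact Nat.log_mono_right (by omega)
  rw [← Finset.sum_fiberwise_of_maps_to (t := L ×ˢ (L ×ˢ L))
    (g := fun r : RefTuple => (lg r.1.1, lg r.1.2.1, lg r.1.2.2)) (by
      intro r hr
      obtain ⟨-, -, -, k1, k2, k3⟩ := hs _ hr
      simp only [Finset.mem_product]
      exact ⟨hmem _ k1, hmem _ k2, hmem _ k3⟩)]
  have hbox : ∀ i ∈ L ×ˢ (L ×ˢ L),
      ∑ r ∈ s with (lg r.1.1, lg r.1.2.1, lg r.1.2.2) = i, r.weight ≤ (6144 : ℝ) := by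
    rintro ⟨i, j, k⟩ -
    have hP : (0 : ℝ) < 2 ^ i := by positivity
    have hQ : (0 : ℝ) < 2 ^ j := by positivity
    have hR : (0 : ℝ) < 2 ^ k := by positivity
    have hin : ∀ r ∈ s.filter (fun r => (lg r.1.1, lg r.1.2.1, lg r.1.2.2) = (i, j, k)),
        InBox (2 ^ i) (2 ^ j) (2 ^ k) r := by
      intro r hr
      obtain ⟨hrs, hi⟩ := Finset.mem_filter.1 hr
      have hc := (hs _ hrs).1.1
      simp only [Prod.mk.injEq] at hi
      obtain ⟨rfl, rfl, rfl⟩ := hi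
      exact ⟨pow_log_toNat_le hc.posA, pow_log_toNat_le hc.posB, pow_log_toNat_le hc.posC⟩
    have hcard := card_refTuple_box_le hP hQ hR N
      (s.filter (fun r => (lg r.1.1, lg r.1.2.1, lg r.1.2.2) = (i, j, k))) (by
        intro r hr
        obtain ⟨k1, k2, k3, k4⟩ := hs _ (Finset.mem_filter.1 hr).1
        exact ⟨k1, hin r hr, k2, k3, k4⟩)
    calc _ ≤ ∑ r ∈ s with (lg r.1.1, lg r.1.2.1, lg r.1.2.2) = (i, j, k),
          1 / ((2 : ℝ) ^ i * 2 ^ j * 2 ^ k) := by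
          apply Finset.sum_le_sum
          intro r hr
          obtain ⟨⟨a, -⟩, ⟨b, -⟩, ⟨c, -⟩⟩ := hin r hr
          have a0 := hP.le.trans a
          have b0 := hQ.le.trans b
          unfold RefTuple.weight
          gcongr
      _ ≤ 6144 := by
          rw [Finset.sum_const, nsmul_eq_mul, mul_one_div, div_le_iff₀ (by positivity)]
          exact hcard
  refine (Finset.sum_le_sum hbox).trans (le_of_eq ?_)
  simp only [Finset.sum_const, Finset.card_product, hL, Finset.card_range, nsmul_eq_mul]
  push_cast
  ring

lemma sum_weight_le_of_injOn (N : ℕ) (s : Finset RefTuple) (f : RefTuple → ℤ × ℤ × ℤ)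
    (hinj : Set.InjOn f s)
    (hf : ∀ r ∈ s, r.weight = 1 / ((f r).1 : ℝ) * (1 / ((f r).2.1 : ℝ)) ∧
      (f r).1 ∈ Finset.Icc (1 : ℤ) N ∧ (f r).2.1 ∈ Finset.Icc (1 : ℤ) N ∧
      (f r).2.2 ∈ ({1, -1} : Finset ℤ)) :
    ∑ r ∈ s, r.weight ≤ 2 * (1 + Real.log N) ^ 2 := by
  set D := Finset.Icc (1 : ℤ) N with hD
  have h0 : 0 ≤ ∑ d ∈ D, 1 / (d : ℝ) := Finset.sum_nonneg fun d hd => by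
    have : (0 : ℝ) < d := by exact_mod_cast (Finset.mem_Icc.1 hd).1
    positivity
  calc ∑ r ∈ s, r.weight = ∑ r ∈ s, 1 / ((f r).1 : ℝ) * (1 / ((f r).2.1 : ℝ)) :=
        Finset.sum_congr rfl fun r hr => (hf r hr).1
    _ = ∑ x ∈ s.image f, 1 / (x.1 : ℝ) * (1 / (x.2.1 : ℝ)) :=
        (Finset.sum_image (f := fun x : ℤ × ℤ × ℤ => 1 / (x.1 : ℝ) * (1 / (x.2.1 : ℝ))) hinj).symm
    _ ≤ ∑ x ∈ D ×ˢ (D ×ˢ ({1, -1} : Finset ℤ)), 1 / (x.1 : ℝ) * (1 / (x.2.1 : ℝ)) := by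
        apply Finset.sum_le_sum_of_subset_of_nonneg
        · intro x hx
          obtain ⟨r, hr, rfl⟩ := Finset.mem_image.1 hx
          simp only [Finset.mem_product]
          exact (hf r hr).2
        · intro x hx _
          simp only [Finset.mem_product, hD, Finset.mem_Icc] at hx
          have h1 : (0 : ℝ) < x.1 := by exact_mod_cast hx.1.1
          have h2 : (0 : ℝ) < x.2.1 := by exact_mod_cast hx.2.1.1
          positivity
    _ = (∑ d ∈ D, 1 / (d : ℝ)) * ((∑ d ∈ D, 1 / (d : ℝ)) * 2) := by
        rw [Finset.sum_product]
        simp only [Finset.sum_product, ← Finset.mul_sum, Finset.sum_const]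
        rw [← Finset.sum_mul]
        have h2 : ∑ d ∈ D, ({1, -1} : Finset ℤ).card • (1 / (d : ℝ)) =
            (∑ d ∈ D, 1 / (d : ℝ)) * 2 := by
          rw [Finset.sum_mul]
          exact Finset.sum_congr rfl fun d _ => by simp [mul_comm]
        rw [h2]
    _ ≤ (1 + Real.log N) * ((1 + Real.log N) * 2) := by
        have := sum_inv_le N
        gcongr
    _ = 2 * (1 + Real.log N) ^ 2 := by ring

lemma IsReference.eq_one_of_fst_eq_zero {A B C d₁ d₂ d₃ v w : ℤ} (hc : IsConicCoeff A B C)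
    (h : IsReference A B C d₁ d₂ d₃ 0 v w) :
    B = 1 ∧ C = 1 ∧ d₂ = 1 ∧ d₃ = 1 ∧ w = 1 ∧ (v = 1 ∨ v = -1) := by
  have hv := Int.isUnit_iff.1 (isCoprime_zero_left.1 h.point.copuv)
  have hw := Int.isUnit_iff.1 (isCoprime_zero_left.1 h.point.copuw)
  have hB := Int.isUnit_iff.1 (isCoprime_zero_left.1 (h.point.cop_u_B hc))
  have hC := Int.isUnit_iff.1 (isCoprime_zero_left.1 (h.point.cop_u_C hc))
  have hB0 := hc.posB
  have hC0 := hc.posC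
  have hw0 := h.posw
  obtain rfl : B = 1 := by omega
  obtain rfl : C = 1 := by omega
  have h2 := Int.le_of_dvd one_pos h.dvd₂
  have h3 := Int.le_of_dvd one_pos h.dvd₃
  have h2' := h.pos₂
  have h3' := h.pos₃
  refine ⟨rfl, rfl, by omega, by omega, by omega, hv⟩

lemma IsReference.eq_one_of_snd_eq_zero {A B C d₁ d₂ d₃ u w : ℤ} (hc : IsConicCoeff A B C)
    (h : IsReference A B C d₁ d₂ d₃ u 0 w) :
    A = 1 ∧ C = 1 ∧ d₁ = 1 ∧ d₃ = 1 ∧ w = 1 ∧ (u = 1 ∨ u = -1) := by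
  have hu := Int.isUnit_iff.1 (isCoprime_zero_right.1 h.point.copuv)
  have hw := Int.isUnit_iff.1 (isCoprime_zero_left.1 h.point.copvw)
  have hA := Int.isUnit_iff.1 (isCoprime_zero_left.1 (h.point.cop_v_A hc))
  have hC := Int.isUnit_iff.1 (isCoprime_zero_left.1 (h.point.cop_v_C hc))
  have hA0 := hc.posA
  have hC0 := hc.posC
  have hw0 := h.posw
  obtain rfl : A = 1 := by omega
  obtain rfl : C = 1 := by omega
  have h2 := Int.le_of_dvd one_pos h.dvd₁
  have h3 := Int.le_of_dvd one_pos h.dvd₃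
  have h2' := h.pos₁
  have h3' := h.pos₃
  refine ⟨rfl, rfl, by omega, by omega, by omega, hu⟩

lemma ediv_mem_Icc {d A : ℤ} {N : ℕ} (hd : 0 < d) (hA : 0 < A) (hdA : d ∣ A) (hN : A ≤ N) :
    d ∈ Finset.Icc (1 : ℤ) N ∧ A / d ∈ Finset.Icc (1 : ℤ) N := by
  obtain ⟨e, rfl⟩ := hdA
  have he : 0 < e := (mul_pos_iff_of_pos_left hd).1 hA
  rw [Int.mul_ediv_cancel_left _ hd.ne']
  simp only [Finset.mem_Icc]
  refine ⟨⟨hd, ?_⟩, he, ?_⟩ <;> nlinarith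

lemma sum_weight_fst_zero_le (N : ℕ) (s : Finset RefTuple)
    (hs : ∀ r ∈ s, IsRefTuple r ∧ r.2.2.1 = 0 ∧ r.1.1 ≤ N) :
    ∑ r ∈ s, r.weight ≤ 2 * (1 + Real.log N) ^ 2 := by
  apply sum_weight_le_of_injOn N s (fun r => (r.2.1.1, r.1.1 / r.2.1.1, r.2.2.2.1))
  · rintro ⟨⟨A, B, C⟩, ⟨d₁, d₂, d₃⟩, ⟨u, v, w⟩⟩ hr
      ⟨⟨A', B', C'⟩, ⟨d₁', d₂', d₃'⟩, ⟨u', v', w'⟩⟩ hr' h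
    obtain ⟨⟨hc, hr⟩, hu, -⟩ := hs _ hr
    obtain ⟨⟨hc', hr'⟩, hu', -⟩ := hs _ hr'
    simp only [Prod.mk.injEq] at h
    dsimp only at *
    subst hu hu'
    obtain ⟨rfl, h, rfl⟩ := h
    obtain ⟨rfl, rfl, rfl, rfl, rfl, -⟩ := hr.eq_one_of_fst_eq_zero hc
    obtain ⟨rfl, rfl, rfl, rfl, rfl, -⟩ := hr'.eq_one_of_fst_eq_zero hc'
    have : A = A' := by rw [← Int.ediv_mul_cancel hr.dvd₁, h, Int.ediv_mul_cancel hr'.dvd₁]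
    rw [this]
  · rintro ⟨⟨A, B, C⟩, ⟨d₁, d₂, d₃⟩, ⟨u, v, w⟩⟩ hr
    obtain ⟨⟨hc, hr⟩, hu, hN⟩ := hs _ hr
    dsimp only at *
    subst hu
    obtain ⟨rfl, rfl, rfl, rfl, rfl, hv⟩ := hr.eq_one_of_fst_eq_zero hc
    obtain ⟨h1, h2⟩ := ediv_mem_Icc hr.pos₁ hc.posA hr.dvd₁ hN
    refine ⟨?_, h1, h2, by simpa using hv⟩
    have : (A : ℝ) = ((A / d₁ : ℤ) : ℝ) * d₁ := by
      exact_mod_cast (Int.ediv_mul_cancel hr.dvd₁).symm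
    simp only [RefTuple.weight, Int.cast_one, mul_one]
    rw [this, one_div_mul_one_div, mul_comm]

lemma sum_weight_snd_zero_le (N : ℕ) (s : Finset RefTuple)
    (hs : ∀ r ∈ s, IsRefTuple r ∧ r.2.2.2.1 = 0 ∧ r.1.2.1 ≤ N) :
    ∑ r ∈ s, r.weight ≤ 2 * (1 + Real.log N) ^ 2 := by
  apply sum_weight_le_of_injOn N s (fun r => (r.2.1.2.1, r.1.2.1 / r.2.1.2.1, r.2.2.1))
  · rintro ⟨⟨A, B, C⟩, ⟨d₁, d₂, d₃⟩, ⟨u, v, w⟩⟩ hr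
      ⟨⟨A', B', C'⟩, ⟨d₁', d₂', d₃'⟩, ⟨u', v', w'⟩⟩ hr' h
    obtain ⟨⟨hc, hr⟩, hu, -⟩ := hs _ hr
    obtain ⟨⟨hc', hr'⟩, hu', -⟩ := hs _ hr'
    simp only [Prod.mk.injEq] at h
    dsimp only at *
    subst hu hu'
    obtain ⟨rfl, h, rfl⟩ := h
    obtain ⟨rfl, rfl, rfl, rfl, rfl, -⟩ := hr.eq_one_of_snd_eq_zero hc
    obtain ⟨rfl, rfl, rfl, rfl, rfl, -⟩ := hr'.eq_one_of_snd_eq_zero hc'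
    have : B = B' := by rw [← Int.ediv_mul_cancel hr.dvd₂, h, Int.ediv_mul_cancel hr'.dvd₂]
    rw [this]
  · rintro ⟨⟨A, B, C⟩, ⟨d₁, d₂, d₃⟩, ⟨u, v, w⟩⟩ hr
    obtain ⟨⟨hc, hr⟩, hu, hN⟩ := hs _ hr
    dsimp only at *
    subst hu
    obtain ⟨rfl, rfl, rfl, rfl, rfl, hv⟩ := hr.eq_one_of_snd_eq_zero hc
    obtain ⟨h1, h2⟩ := ediv_mem_Icc hr.pos₂ hc.posB hr.dvd₂ hN
    refine ⟨?_, h1, h2, by simpa using hv⟩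
    have : (B : ℝ) = ((B / d₂ : ℤ) : ℝ) * d₂ := by
      exact_mod_cast (Int.ediv_mul_cancel hr.dvd₂).symm
    simp only [RefTuple.weight, Int.cast_one, mul_one, one_mul]
    rw [this, one_div_mul_one_div, mul_comm]

lemma sum_weight_le (N : ℕ) (s : Finset RefTuple)
    (hs : ∀ r ∈ s, IsRefTuple r ∧ r.1.1 ≤ N ∧ r.1.2.1 ≤ N ∧ r.1.2.2 ≤ N) :
    ∑ r ∈ s, r.weight ≤
      6144 * ((Nat.log 2 N : ℝ) + 1) ^ 3 + 4 * (1 + Real.log N) ^ 2 := by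
  rw [← Finset.sum_filter_add_sum_filter_not s (fun r => r.2.2.1 = 0)]
  rw [← Finset.sum_filter_add_sum_filter_not (s.filter (fun r => ¬ r.2.2.1 = 0))
    (fun r => r.2.2.2.1 = 0)]
  have h1 := sum_weight_fst_zero_le N (s.filter (fun r => r.2.2.1 = 0)) (by
    intro r hr
    obtain ⟨hr, h⟩ := Finset.mem_filter.1 hr
    exact ⟨(hs r hr).1, h, (hs r hr).2.1⟩)
  have h2 := sum_weight_snd_zero_le N
    ((s.filter (fun r => ¬ r.2.2.1 = 0)).filter (fun r => r.2.2.2.1 = 0)) (by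
    intro r hr
    obtain ⟨hr, h⟩ := Finset.mem_filter.1 hr
    have hr := (Finset.mem_filter.1 hr).1
    exact ⟨(hs r hr).1, h, (hs r hr).2.2.1⟩)
  have h3 := sum_weight_nonzero_le N
    ((s.filter (fun r => ¬ r.2.2.1 = 0)).filter (fun r => ¬ r.2.2.2.1 = 0)) (by
    intro r hr
    obtain ⟨hr, h⟩ := Finset.mem_filter.1 hr
    obtain ⟨hr, h'⟩ := Finset.mem_filter.1 hr
    exact ⟨(hs r hr).1, h', h, (hs r hr).2⟩)
  linarith

/-- A positive point on the conic `A u² + B v² = C w²`, with bounded height and coefficients. -/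
structure IsBoundedPoint (T : ℝ) (A B C u v w : ℤ) : Prop where
  coeff : IsConicCoeff A B C
  point : IsConicPoint A B C u v w
  posu : 0 < u
  posv : 0 < v
  posw : 0 < w
  height : (A * B * C ^ 2 * w ^ 2 : ℝ) ≤ 2 * T
  small : (A * B * C : ℝ) ≤ 2 * √T

lemma card_boundedPoint_fiber_le {T : ℝ} (hT : 0 < T) {r : RefTuple} (hr : IsRefTuple r)
    (hsmall : (r.1.1 * r.1.2.1 * r.1.2.2 : ℝ) ≤ 2 * √T) (s : Finset (ℤ × ℤ × ℤ))
    (hs : ∀ p ∈ s, IsBoundedPoint T r.1.1 r.1.2.1 r.1.2.2 p.1 p.2.1 p.2.2 ∧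
      RefersTo r.1.1 r.1.2.1 r.1.2.2 r.2.1.1 r.2.1.2.1 r.2.1.2.2 r.2.2.1 r.2.2.2.1 r.2.2.2.2
        p.1 p.2.1 p.2.2) :
    (s.card : ℝ) ≤ 4 * √T * r.weight := by
  obtain ⟨⟨A, B, C⟩, ⟨d₁, d₂, d₃⟩, ⟨u, v, w⟩⟩ := r
  obtain ⟨hc, hr⟩ := hr
  dsimp only at *
  have hA : (0 : ℝ) < A := by exact_mod_cast hc.posA
  have hB : (0 : ℝ) < B := by exact_mod_cast hc.posB
  have hC : (0 : ℝ) < C := by exact_mod_cast hc.posC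
  have hAB : √(A * B : ℝ) ^ 2 = A * B := Real.sq_sqrt (by positivity)
  have hAB0 : 0 < √(A * B : ℝ) := by positivity
  have h2 : (0 : ℝ) < √2 := by positivity
  set W : ℝ := √(2 * T) / (√(A * B : ℝ) * C) with hW
  have key := card_same_reference_le (W := W) (by positivity) hc hr s (by
    intro p hp
    obtain ⟨hp, href⟩ := hs p hp
    refine ⟨hp.posu, hp.posv, hp.posw, hp.point, ?_, href⟩
    have hw : (0 : ℝ) < p.2.2 := by exact_mod_cast hp.posw
    rw [hW, le_div_iff₀ (by positivity)]
    apply Real.le_sqrt_of_sq_le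
    have := hp.height
    calc (p.2.2 * (√(A * B : ℝ) * C)) ^ 2 = √(A * B : ℝ) ^ 2 * C ^ 2 * (p.2.2 : ℝ) ^ 2 := by ring
      _ ≤ 2 * T := by rw [hAB]; exact this)
  have hval : 2 / (√(2 * A * B : ℝ) / W) = 2 * √T / (A * B * C) := by
    rw [hW, mul_assoc, Real.sqrt_mul zero_le_two, Real.sqrt_mul zero_le_two]
    field_simp
    rw [hAB]
  have h1 : 1 ≤ 2 * √T / (A * B * C) := by
    rw [le_div_iff₀ (by positivity), one_mul]
    exact hsmall
  calc (s.card : ℝ) ≤ 1 + 2 * √T / (A * B * C) := by rw [← hval]; exact key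
    _ ≤ 2 * √T / (A * B * C) + 2 * √T / (A * B * C) := by linarith
    _ = _ := by
      unfold RefTuple.weight
      ring

lemma card_boundedPoint_le {T : ℝ} (hT : 0 < T) (s : Finset ((ℤ × ℤ × ℤ) × (ℤ × ℤ × ℤ)))
    (hs : ∀ x ∈ s, IsBoundedPoint T x.1.1 x.1.2.1 x.1.2.2 x.2.1 x.2.2.1 x.2.2.2) :
    (s.card : ℝ) ≤ 4 * √T * (6144 * ((Nat.log 2 ⌊2 * √T⌋₊ : ℝ) + 1) ^ 3 +
      4 * (1 + Real.log ⌊2 * √T⌋₊) ^ 2) := by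
  have hex : ∀ x : (ℤ × ℤ × ℤ) × (ℤ × ℤ × ℤ), ∃ r : RefTuple, x ∈ s → IsRefTuple r ∧ r.1 = x.1 ∧
      RefersTo r.1.1 r.1.2.1 r.1.2.2 r.2.1.1 r.2.1.2.1 r.2.1.2.2 r.2.2.1 r.2.2.2.1 r.2.2.2.2
        x.2.1 x.2.2.1 x.2.2.2 := by
    intro x
    by_cases hx : x ∈ s
    · have h := hs x hx
      obtain ⟨d₁, d₂, d₃, u, v, w, h1, h2⟩ := exists_reference h.coeff h.point h.posw
      exact ⟨(x.1, (d₁, d₂, d₃), (u, v, w)), fun _ => ⟨⟨h.coeff, h1⟩, rfl, h2⟩⟩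
    · exact ⟨default, fun h => absurd h hx⟩
  choose g hg using hex
  have key := card_le_sum_of_card_fiber_le s (s.image g) g (fun r => 4 * √T * r.weight)
    (fun x hx => Finset.mem_image_of_mem g hx) (by
      intro r hr
      obtain ⟨a, ha, rfl⟩ := Finset.mem_image.1 hr
      obtain ⟨h1, h2, -⟩ := hg a ha
      have hfib : ∀ x ∈ s.filter (fun x => g x = g a), x ∈ s ∧ x.1 = (g a).1 := by
        intro x hx
        obtain ⟨hx, hxa⟩ := Finset.mem_filter.1 hx
        exact ⟨hx, by rw [← hxa, (hg x hx).2.1]⟩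
      rw [← Finset.card_image_of_injOn (f := Prod.snd)]
      · apply card_boundedPoint_fiber_le hT h1
        · rw [h2]
          exact (hs a ha).small
        · intro p hp
          obtain ⟨x, hx, rfl⟩ := Finset.mem_image.1 hp
          obtain ⟨hxs, hx1⟩ := hfib x hx
          have h3 := (hg x hxs).2.2
          rw [(Finset.mem_filter.1 hx).2] at h3
          refine ⟨?_, h3⟩
          rw [← hx1]
          exact hs x hxs
      · intro x hx y hy hxy
        exact Prod.ext ((hfib x hx).2.trans (hfib y hy).2.symm) hxy)
  rw [← Finset.mul_sum] at key
  refine key.trans ?_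
  gcongr
  apply sum_weight_le
  intro r hr
  obtain ⟨a, ha, rfl⟩ := Finset.mem_image.1 hr
  obtain ⟨h1, h2, -⟩ := hg a ha
  have hb := (hs a ha).small
  have hc := (hs a ha).coeff
  rw [h2]
  have hprod : a.1.1 * a.1.2.1 * a.1.2.2 ≤ (⌊2 * √T⌋₊ : ℤ) := by
    rw [Int.natCast_floor_eq_floor (by positivity)]
    apply Int.le_floor.2
    exact_mod_cast hb
  have hA := hc.posA
  have hB := hc.posB
  have hC := hc.posC
  exact ⟨h1,
    (Int.le_of_dvd (by positivity) (by rw [mul_assoc]; exact dvd_mul_right _ _)).trans hprod,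
    (Int.le_of_dvd (by positivity) ((dvd_mul_left _ _).mul_right _)).trans hprod,
    (Int.le_of_dvd (by positivity) (dvd_mul_left _ _)).trans hprod⟩

lemma mul_le_two_sqrt_of_height_le {T A B C u v w : ℝ} (hT : 0 < T) (hA : 0 < A) (hB : 0 < B)
    (hC : 0 < C) (hu : 0 < u) (hv : 0 < v) (hw : 0 < w) (h : A * u ^ 2 + B * v ^ 2 = C * w ^ 2)
    (hh : A * B * C ^ 2 * w ^ 2 ≤ 2 * T) (hy : √T < u * v * w) :
    A * B * C ≤ 2 * √T := by
  have h1 : A * u ^ 2 ≤ C * w ^ 2 := by rw [← h]; exact le_add_of_nonneg_right (by positivity)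
  have h2 : B * v ^ 2 ≤ C * w ^ 2 := by rw [← h]; exact le_add_of_nonneg_left (by positivity)
  have h3 : T ≤ (u * v * w) ^ 2 := (Real.sqrt_lt' (by positivity)).1 hy |>.le
  have h4 : T * (A * B) ≤ C ^ 2 * w ^ 6 := by
    calc T * (A * B) ≤ (u * v * w) ^ 2 * (A * B) := by gcongr
      _ = (A * u ^ 2) * (B * v ^ 2) * w ^ 2 := by ring
      _ ≤ (C * w ^ 2) * (C * w ^ 2) * w ^ 2 := by gcongr
      _ = C ^ 2 * w ^ 6 := by ring
  have h5 : T * (A * B * C) ^ 4 * C ^ 2 ≤ T * (4 * T) ^ 2 * C ^ 2 := by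
    calc T * (A * B * C) ^ 4 * C ^ 2 = T * (A * B) * (A * B * C ^ 2) ^ 3 := by ring
      _ ≤ C ^ 2 * w ^ 6 * (A * B * C ^ 2) ^ 3 := by gcongr
      _ = C ^ 2 * (A * B * C ^ 2 * w ^ 2) ^ 3 := by ring
      _ ≤ C ^ 2 * (2 * T) ^ 3 := by gcongr
      _ = T * (8 * T ^ 2) * C ^ 2 := by ring
      _ ≤ T * (4 * T) ^ 2 * C ^ 2 := by
        gcongr
        nlinarith [sq_nonneg T]
  have h6 : ((A * B * C) ^ 2) ^ 2 ≤ (4 * T) ^ 2 := by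
    rw [← pow_mul]
    exact le_of_mul_le_mul_left (le_of_mul_le_mul_right h5 (by positivity)) hT
  have h7 : (A * B * C) ^ 2 ≤ (2 * √T) ^ 2 := by
    rw [mul_pow 2, Real.sq_sqrt hT.le]
    have := (pow_le_pow_iff_left₀ (by positivity) (by positivity) two_ne_zero).1 h6
    linarith
  exact (pow_le_pow_iff_left₀ (by positivity) (by positivity) two_ne_zero).1 h7

lemma isBoundedPoint_of_height_le {T : ℝ} (hT : 0 < T) {A B C u v w : ℤ}
    (hc : IsConicCoeff A B C) (hp : IsConicPoint A B C u v w) (hu : u ≠ 0) (hv : v ≠ 0)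
    (hw : w ≠ 0) (hh : (A * B * C ^ 2 * w ^ 2 : ℝ) ≤ 2 * T)
    (hy : √T < ((|u * v * w| : ℤ) : ℝ)) :
    IsBoundedPoint T A B C |u| |v| |w| where
  coeff := hc
  point := ⟨by simpa only [sq_abs] using hp.eqn, hp.copuv.abs_abs, hp.copuw.abs_abs,
    hp.copvw.abs_abs⟩
  posu := abs_pos.2 hu
  posv := abs_pos.2 hv
  posw := abs_pos.2 hw
  height := by
    rw [Int.cast_abs, sq_abs]
    exact hh
  small := by
    have e : (A * u ^ 2 + B * v ^ 2 : ℝ) = C * w ^ 2 := by exact_mod_cast hp.eqn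
    refine mul_le_two_sqrt_of_height_le hT (u := |(u : ℝ)|) (v := |(v : ℝ)|) (w := |(w : ℝ)|)
      (by exact_mod_cast hc.posA) (by exact_mod_cast hc.posB) (by exact_mod_cast hc.posC)
      (by simpa using hu) (by simpa using hv) (by simpa using hw) ?_ ?_ ?_
    · simpa only [sq_abs] using e
    · simpa only [sq_abs] using hh
    · rw [← abs_mul, ← abs_mul]
      exact_mod_cast hy

lemma finite_setOf_isBoundedPoint (T : ℝ) :
    {x : (ℤ × ℤ × ℤ) × (ℤ × ℤ × ℤ) |
      IsBoundedPoint T x.1.1 x.1.2.1 x.1.2.2 x.2.1 x.2.2.1 x.2.2.2}.Finite := by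
  set D := Finset.Icc (1 : ℤ) ⌊2 * T⌋ with hD
  refine (Finset.finite_toSet ((D ×ˢ (D ×ˢ D)) ×ˢ (D ×ˢ (D ×ˢ D)))).subset ?_
  rintro ⟨⟨A, B, C⟩, ⟨u, v, w⟩⟩ hx
  have hx : IsBoundedPoint T A B C u v w := hx
  have hA := hx.coeff.posA
  have hB := hx.coeff.posB
  have hC := hx.coeff.posC
  have hu := hx.posu
  have hv := hx.posv
  have hw := hx.posw
  have hM : A * B * C ^ 2 * w ^ 2 ≤ ⌊2 * T⌋ := by
    apply Int.le_floor.2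
    exact_mod_cast hx.height
  have hpos : 0 < A * B * C ^ 2 * w ^ 2 := by positivity
  have hdvd : ∀ {n : ℤ}, n ∣ A * B * C ^ 2 * w ^ 2 → n ≤ ⌊2 * T⌋ := fun h =>
    (Int.le_of_dvd hpos h).trans hM
  have hCw : C * w ^ 2 ≤ ⌊2 * T⌋ := hdvd ⟨A * B * C, by ring⟩
  have e := hx.point.eqn
  have hu2 : 0 < A * u ^ 2 := by positivity
  have hv2 : 0 < B * v ^ 2 := by positivity
  simp only [hD, Finset.coe_product, Set.mem_prod, Finset.coe_Icc, Set.mem_Icc]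
  refine ⟨⟨⟨hA, hdvd ⟨B * C ^ 2 * w ^ 2, by ring⟩⟩, ⟨hB, hdvd ⟨A * C ^ 2 * w ^ 2, by ring⟩⟩,
    ⟨hC, hdvd ⟨A * B * C * w ^ 2, by ring⟩⟩⟩, ⟨hu, ?_⟩, ⟨hv, ?_⟩,
    ⟨hw, hdvd ⟨A * B * C ^ 2 * w, by ring⟩⟩⟩
  · have := Int.le_of_dvd hu2 (show u ∣ _ from ⟨A * u, by ring⟩)
    linarith
  · have := Int.le_of_dvd hv2 (show v ∣ _ from ⟨B * v, by ring⟩)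
    linarith

/-- The solution of `x₁ y₁² + x₂ y₂² = x₃ y₃²` obtained from a point on `A u² + B v² = C w²` by
changing signs of the variables and, if the flag is set, moving `A u²` to the other side. -/
def signedTuple (p : Bool × (ℤ × ℤ × ℤ) × ((ℤ × ℤ × ℤ) × (ℤ × ℤ × ℤ))) :
    ℤ × ℤ × ℤ × ℤ × ℤ × ℤ :=
  let ((e₁, e₂, e₃), ((A, B, C), (u, v, w))) := p.2
  if p.1 then (C, -A, B, e₃ * w, e₁ * u, e₂ * v) else (A, B, C, e₁ * u, e₂ * v, e₃ * w)

lemma StackyCounted.exists_signedTuple {T : ℝ} (hT : 0 < T) {x₁ x₂ x₃ y₁ y₂ y₃ : ℤ}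
    (h : StackyCounted T x₁ x₂ x₃ y₁ y₂ y₃) (hy : √T < ((|y₁ * y₂ * y₃| : ℤ) : ℝ)) :
    ∃ b e₁ e₂ e₃ A B C u v w,
      e₁ ∈ ({1, -1} : Finset ℤ) ∧ e₂ ∈ ({1, -1} : Finset ℤ) ∧ e₃ ∈ ({1, -1} : Finset ℤ) ∧
      IsBoundedPoint T A B C u v w ∧
      signedTuple (b, (e₁, e₂, e₃), ((A, B, C), (u, v, w))) = (x₁, x₂, x₃, y₁, y₂, y₃) := by
  obtain ⟨-, hx₂, hx₃, hy₁, hy₂, hy₃, c12, c13, c23, k12, k13, k23, s1, s2, s3, eqn, hx₁, hle,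
    hh⟩ := h
  rw [← Int.isCoprime_iff_gcd_eq_one] at c12 c13 c23 k12 k13 k23
  have hsign : ∀ y : ℤ, ∃ e ∈ ({1, -1} : Finset ℤ), e * |y| = y := by
    intro y
    rcases abs_choice y with h | h
    · exact ⟨1, by simp, by rw [h, one_mul]⟩
    · exact ⟨-1, by simp, by rw [h]; ring⟩
  obtain ⟨e₁, he₁, hey₁⟩ := hsign y₁
  obtain ⟨e₂, he₂, hey₂⟩ := hsign y₂
  obtain ⟨e₃, he₃, hey₃⟩ := hsign y₃
  have hy₂' : 0 < y₂ ^ 2 := by positivity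
  have hy₃' : 0 < y₃ ^ 2 := by positivity
  obtain ⟨hle1, hle2⟩ := abs_le.1 hle
  have hx₃' : 0 < x₃ := by
    have : 0 ≤ x₃ * y₃ ^ 2 := by linarith
    exact lt_of_le_of_ne (nonneg_of_mul_nonneg_left this hy₃') hx₃.symm
  rcases lt_or_gt_of_ne hx₂ with hneg | hpos
  · refine ⟨true, e₂, e₃, e₁, -x₂, x₃, x₁, |y₂|, |y₃|, |y₁|, he₂, he₃, he₁, ?_, ?_⟩
    · apply isBoundedPoint_of_height_le hT
        ⟨by linarith, hx₃', hx₁, c23.neg_left, c12.symm.neg_left, c13.symm,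
          s2.squarefree_of_dvd (neg_dvd.2 dvd_rfl), s3, s1⟩
        ⟨by linarith, k23, k12.symm, k13.symm⟩ hy₂ hy₃ hy₁
      · have : -x₂ * x₃ * x₁ ^ 2 * y₁ ^ 2 = |(x₁ * y₁) ^ 2 * x₂ * x₃| := by
          rw [abs_of_nonpos]
          · ring
          · exact mul_nonpos_of_nonpos_of_nonneg
              (mul_nonpos_of_nonneg_of_nonpos (sq_nonneg _) hneg.le) hx₃'.le
        rw [← this] at hh
        push_cast at hh ⊢
        linarith
      · rwa [show y₂ * y₃ * y₁ = y₁ * y₂ * y₃ by ring]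
    · simp [signedTuple, hey₁, hey₂, hey₃]
  · refine ⟨false, e₁, e₂, e₃, x₁, x₂, x₃, |y₁|, |y₂|, |y₃|, he₁, he₂, he₃, ?_, ?_⟩
    · apply isBoundedPoint_of_height_le hT
        ⟨hx₁, hpos, hx₃', c12, c13, c23, s1, s2, s3⟩ ⟨eqn, k12, k13, k23⟩ hy₁ hy₂ hy₃ _ hy
      have h1 : x₁ * x₂ * x₃ ^ 2 * y₃ ^ 2 ≤ 2 * |(x₁ * y₁) ^ 2 * x₂ * x₃| := by
        rw [abs_of_nonneg (by positivity)]
        calc x₁ * x₂ * x₃ ^ 2 * y₃ ^ 2 = x₁ * x₂ * x₃ * (x₃ * y₃ ^ 2) := by ring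
          _ ≤ x₁ * x₂ * x₃ * (2 * (x₁ * y₁ ^ 2)) := by
            refine mul_le_mul_of_nonneg_left ?_ (by positivity)
            linarith
          _ = _ := by ring
      have h2 : ((x₁ * x₂ * x₃ ^ 2 * y₃ ^ 2 : ℤ) : ℝ) ≤
          2 * ((|(x₁ * y₁) ^ 2 * x₂ * x₃| : ℤ) : ℝ) := by exact_mod_cast h1
      push_cast at h2 hh ⊢
      linarith
    · simp [signedTuple, hey₁, hey₂, hey₃]

lemma stackyNlargeY_le {T : ℝ} (hT : 0 < T) :
    (stackyNlargeY T : ℝ) ≤ 16 * (4 * √T * (6144 * ((Nat.log 2 ⌊2 * √T⌋₊ : ℝ) + 1) ^ 3 +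
      4 * (1 + Real.log ⌊2 * √T⌋₊) ^ 2)) := by
  classical
  set s := (finite_setOf_isBoundedPoint T).toFinset with hs
  set E : Finset ℤ := {1, -1} with hE
  have hsub : {v : ℤ × ℤ × ℤ × ℤ × ℤ × ℤ |
      StackyCounted T v.1 v.2.1 v.2.2.1 v.2.2.2.1 v.2.2.2.2.1 v.2.2.2.2.2 ∧
      √T < ((|v.2.2.2.1 * v.2.2.2.2.1 * v.2.2.2.2.2| : ℤ) : ℝ)} ⊆
      ((Finset.univ ×ˢ ((E ×ˢ (E ×ˢ E)) ×ˢ s)).image signedTuple : Finset _) := by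
    rintro ⟨x₁, x₂, x₃, y₁, y₂, y₃⟩ ⟨h, hy⟩
    obtain ⟨b, e₁, e₂, e₃, A, B, C, u, v, w, h1, h2, h3, h4, h5⟩ := h.exists_signedTuple hT hy
    rw [Finset.mem_coe, ← h5]
    apply Finset.mem_image_of_mem
    simp only [Finset.mem_product, Finset.mem_univ, true_and, hs, Set.Finite.mem_toFinset]
    exact ⟨⟨h1, h2, h3⟩, h4⟩
  have hcard : stackyNlargeY T ≤ 16 * s.card := by
    refine (Set.ncard_le_ncard hsub (Finset.finite_toSet _)).trans ?_
    rw [Set.ncard_coe_finset]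
    refine Finset.card_image_le.trans (le_of_eq ?_)
    have hE2 : E.card = 2 := by decide
    simp only [Finset.card_product, hE2, Finset.card_univ, Fintype.card_bool]
    ring
  have hle := card_boundedPoint_le hT s fun x hx =>
    (finite_setOf_isBoundedPoint T).mem_toFinset.1 hx
  calc (stackyNlargeY T : ℝ) ≤ 16 * s.card := by exact_mod_cast hcard
    _ ≤ _ := by gcongr

theorem stackyN_quadratic_case_upper :
    ∃ C : ℝ, 0 < C ∧ ∃ T0 : ℝ, 2 ≤ T0 ∧
      ∀ T : ℝ, T0 ≤ T →
        (stackyNlargeY T : ℝ) ≤ C * Real.sqrt T * (Real.log T) ^ 3 := by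
  refine ⟨64 * (6144 * 27 + 16), by norm_num, 16, by norm_num, fun T hT => ?_⟩
  have hT0 : 0 < T := by linarith
  set N := ⌊2 * √T⌋₊ with hN
  have hsq : √T ^ 2 = T := Real.sq_sqrt hT0.le
  have h4 : 4 ≤ √T := Real.le_sqrt_of_sq_le (by linarith)
  have hN1 : 1 ≤ N := Nat.le_floor (by push_cast; linarith)
  have hN0 : (0 : ℝ) < N := by exact_mod_cast hN1
  have hNT : (N : ℝ) ≤ T := (Nat.floor_le (by positivity)).trans (by nlinarith)
  have hlogN : Real.log N ≤ Real.log T := Real.log_le_log hN0 hNT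
  have hlogN0 : 0 ≤ Real.log N := Real.log_natCast_nonneg N
  have hlog2 := Real.log_two_gt_d9
  have hlogT : 1 ≤ Real.log T := by
    have h16 : Real.log 16 = 4 * Real.log 2 := by
      rw [show (16 : ℝ) = 2 ^ 4 by norm_num, Real.log_pow]
      norm_num
    have := Real.log_le_log (by norm_num) hT
    linarith
  have hnl : (Nat.log 2 N : ℝ) ≤ 2 * Real.log T := by
    have h1 : ((2 ^ Nat.log 2 N : ℕ) : ℝ) ≤ N := by
      exact_mod_cast Nat.pow_log_le_self 2 (by omega)
    have h2 := Real.log_le_log (by positivity) h1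
    rw [Nat.cast_pow, Real.log_pow, Nat.cast_ofNat] at h2
    have h3 : (0 : ℝ) ≤ Nat.log 2 N := Nat.cast_nonneg _
    nlinarith
  calc (stackyNlargeY T : ℝ)
      ≤ 16 * (4 * √T * (6144 * ((Nat.log 2 N : ℝ) + 1) ^ 3 + 4 * (1 + Real.log N) ^ 2)) :=
        stackyNlargeY_le hT0
    _ ≤ 16 * (4 * √T * (6144 * (3 * Real.log T) ^ 3 + 4 * (2 * Real.log T) ^ 2)) := by
        gcongr
        · linarith
        · linarith
    _ ≤ 16 * (4 * √T * (6144 * (3 * Real.log T) ^ 3 + 16 * Real.log T ^ 3)) := by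
        have : 4 * (2 * Real.log T) ^ 2 ≤ 16 * Real.log T ^ 3 := by
          nlinarith [sq_nonneg (Real.log T)]
        gcongr
    _ = 64 * (6144 * 27 + 16) * √T * Real.log T ^ 3 := by ring
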